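/- Let G be a finitely generated abelian group, F a field of characteristic different from 2, and let (A,φ,Γ) satisfy: (A,φ) is a finite-dimensional simple associative algebra with involution, Γ is a (ℤ×G)-grading of A with φ(A_{(i,g)}) = A_{(−i,g)} and induced ℤ-support {−1,0,1}, and (A,Γ) is not graded-simple. Then there exist a simple (ℤ×G)-graded division algebra D with support T, integers k₀, k₁ ≥ 1, tuples γ₀ ∈ G^{k₀} and γ₁ ∈ G^{k₁} of elements pairwise distinct modulo T, and κ₀ ∈ ℤ_{>0}^{k₀}, κ₁ ∈ ℤ_{>0}^{k₁}, such that (A,φ,Γ) ≅ M(G,D,κ₀,κ₁,γ₀,γ₁)^ex. Moreover, M(G,D,κ₀,κ₁,γ₀,γ₁)^ex ≅ M(G,D',κ'₀,κ'₁,γ'₀,γ'₁)^ex holds if either: (1) D ≅ D' as graded algebras and there is g ∈ G with Ξ(κ_i,γ_i) = gΞ(κ'_i,γ'_i) for i = 0,1; or (2) D ≅ (D')^op as graded algebras and there is g ∈ G with Ξ(κ_i,γ_i) = gΞ(κ'_i,(γ'_i)^{−1}) for i = 0,1. -/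

import Mathlib

universe u v w

/-!
STATEMENT 11.  Let (A,φ,Γ) be a finite-dimensional simple associative algebra with involution
over F (char F ≠ 2), with a (ℤ×G)-grading with φ(A₍ᵢ,g₎) = A₍₋ᵢ,g₎ and induced ℤ-support
{−1,0,1}, and assume (A,Γ) is not graded-simple.  Then (A,φ,Γ) ≅ M(G,D,κ₀,κ₁,γ₀,γ₁)^ex for a
simple (ℤ×G)-graded division algebra D, tuples γ₀,γ₁ of elements pairwise distinct modulo
T = supp D and multiplicities κ₀,κ₁.  Moreover two such models are isomorphic if either
(1) D ≅ D' graded and Ξ(κᵢ,γᵢ) = gΞ(κ'ᵢ,γ'ᵢ) (i = 0,1) for some g, or (2) D ≅ (D')^op graded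
and Ξ(κᵢ,γᵢ) = gΞ(κ'ᵢ,(γ'ᵢ)⁻¹) (i = 0,1) for some g.

The repeated tuple γ(κ,γ) is realized by indexing the matrix rows of each block by the type
Σ i, Fin (κ i), an index ⟨i,r⟩ carrying the group element γ i.
-/

/-- Packaged (ℤ×G)-graded algebra. -/
structure GrAlg (F : Type u) [Field F] (ι : Type v) : Type (max u v (w + 1)) where
  carrier : Type w
  [ring : Ring carrier]
  [alg : Algebra F carrier]
  gr : ι → Submodule F carrier

attribute [instance] GrAlg.ring GrAlg.alg

variable {F : Type u} [Field F] {G : Type v} [CommGroup G]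

/-- `E.gr` is a (ℤ×G)-grading of the algebra `E.carrier`. -/
def IsGrading [DecidableEq G] (E : GrAlg.{u, v, w} F (ℤ × G)) : Prop :=
  DirectSum.IsInternal E.gr ∧ (1 : E.carrier) ∈ E.gr (0, 1) ∧
    ∀ p q : ℤ × G, ∀ x ∈ E.gr p, ∀ y ∈ E.gr q, x * y ∈ E.gr (p.1 + q.1, p.2 * q.2)

/-- `E` is a finite-dimensional (ℤ×G)-graded division algebra. -/
def IsGradedDivision [DecidableEq G] (E : GrAlg.{u, v, w} F (ℤ × G)) : Prop :=
  IsGrading E ∧ FiniteDimensional F E.carrier ∧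
    ∀ p : ℤ × G, ∀ x ∈ E.gr p, x ≠ 0 → IsUnit x

/-- `E.carrier` is a simple algebra. -/
def IsSimpleAlg (E : GrAlg.{u, v, w} F (ℤ × G)) : Prop :=
  Nontrivial E.carrier ∧
    ∀ K : Submodule F E.carrier,
      (∀ a : E.carrier, ∀ x ∈ K, a * x ∈ K ∧ x * a ∈ K) → K = ⊥ ∨ K = ⊤

/-- The exchange involution `(x,y) ↦ (y,x)` on `B ⊕ B^op`. -/
def exInv (F : Type u) [Field F] (B : Type*) [Ring B] [Algebra F B] :
    (B × Bᵐᵒᵖ) →ₗ[F] (B × Bᵐᵒᵖ) :=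
  (((MulOpposite.opLinearEquiv F).symm.toLinearMap).comp (LinearMap.snd F B Bᵐᵒᵖ)).prod
    (((MulOpposite.opLinearEquiv F).toLinearMap).comp (LinearMap.fst F B Bᵐᵒᵖ))

/-- The opposite grading on `B^op`: `(B^op)₍ᵢ,g₎ = B₍₋ᵢ,g₎`. -/
def opGr {B : Type*} [Ring B] [Algebra F B] (Γ : ℤ × G → Submodule F B) :
    ℤ × G → Submodule F Bᵐᵒᵖ :=
  fun p => (Γ (-p.1, p.2)).map (MulOpposite.opLinearEquiv F).toLinearMap

/-- The exchange grading on `B ⊕ B^op`. -/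
def exGr {B : Type*} [Ring B] [Algebra F B] (Γ : ℤ × G → Submodule F B) :
    ℤ × G → Submodule F (B × Bᵐᵒᵖ) :=
  fun p => (Γ p).prod ((Γ (-p.1, p.2)).map (MulOpposite.opLinearEquiv F).toLinearMap)

/-- The grading of a matrix algebra over `D` determined by a tuple `γ` and parities `δ`. -/
def matGr {D : Type w} [Ring D] [Algebra F D] (Dgr : ℤ × G → Submodule F D)
    {ι : Type*} (γ : ι → G) (δ : ι → ℤ) (p : ℤ × G) : Submodule F (Matrix ι ι D) where
  carrier := {X | ∀ i j, X i j ∈ Dgr (p.1 - δ i + δ j, (γ i)⁻¹ * p.2 * γ j)}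
  add_mem' := by
    intro X Y hX hY i j
    simpa [Matrix.add_apply] using add_mem (hX i j) (hY i j)
  zero_mem' := by
    intro i j
    simp only [Matrix.zero_apply]
    exact Submodule.zero_mem _
  smul_mem' := by
    intro c X hX i j
    simpa [Matrix.smul_apply] using Submodule.smul_mem _ c (hX i j)

/-- The index type of the matrix algebra `M(G,D,κ₀,κ₁,γ₀,γ₁)`: each index of the first
(δ = 0) block repeated `κ₀ i` times, each index of the second (δ = 1) block repeated
`κ₁ i` times. -/
def RepIdx {k₀ k₁ : ℕ} (κ₀ : Fin k₀ → ℕ) (κ₁ : Fin k₁ → ℕ) : Type :=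
  (Σ i : Fin k₀, Fin (κ₀ i)) ⊕ (Σ i : Fin k₁, Fin (κ₁ i))

instance {k₀ k₁ : ℕ} (κ₀ : Fin k₀ → ℕ) (κ₁ : Fin k₁ → ℕ) : Fintype (RepIdx κ₀ κ₁) := by
  unfold RepIdx; infer_instance

instance {k₀ k₁ : ℕ} (κ₀ : Fin k₀ → ℕ) (κ₁ : Fin k₁ → ℕ) : DecidableEq (RepIdx κ₀ κ₁) := by
  unfold RepIdx; infer_instance

/-- The repeated tuple `γ(κ₀,γ₀),γ(κ₁,γ₁)` as a function on `RepIdx κ₀ κ₁`. -/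
def repGamma {k₀ k₁ : ℕ} {κ₀ : Fin k₀ → ℕ} {κ₁ : Fin k₁ → ℕ}
    (γ₀ : Fin k₀ → G) (γ₁ : Fin k₁ → G) : RepIdx κ₀ κ₁ → G :=
  Sum.elim (fun x => γ₀ x.1) fun x => γ₁ x.1

/-- The parity vector: 0 on the first block, 1 on the second. -/
def repDelta {k₀ k₁ : ℕ} (κ₀ : Fin k₀ → ℕ) (κ₁ : Fin k₁ → ℕ) : RepIdx κ₀ κ₁ → ℤ :=
  Sum.elim (fun _ => 0) fun _ => 1

/-- `gΞ(κ,γ)`: the multiset of cosets modulo `T` of the entries of the repeated tuple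
`γ(κ,γ)`, translated by `g`. -/
def Xi (T : Subgroup G) (g : G) {k : ℕ} (κ : Fin k → ℕ) (γ : Fin k → G) :
    Multiset (G ⧸ T) :=
  (Finset.univ.val : Multiset (Σ i : Fin k, Fin (κ i))).map fun x => ((g * γ x.1 : G) : G ⧸ T)

section GradedStructure

variable {A : Type w} [Ring A] [Algebra F A] {ι : Type*} [AddCommGroup ι] [DecidableEq ι]
  (𝒜 : ι → Submodule F A) [GradedAlgebra 𝒜]

open DirectSum in
lemma exists_homogeneous_left_factor {a x t : A} {p q : ι} (ha : a ∈ 𝒜 p) (hx : x ∈ 𝒜 q)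
    (h : t * a = x) : ∃ t' ∈ 𝒜 (q - p), t' * a = x := by
  refine ⟨decompose 𝒜 t (q - p), SetLike.coe_mem _, ?_⟩
  rw [← coe_decompose_mul_add_of_right_mem 𝒜 ha, h, sub_add_cancel,
    decompose_of_mem_same 𝒜 hx]

lemma inverse_homogeneous {u v : A} {p : ι} (hu : u ∈ 𝒜 p) (hvu : v * u = 1) (huv : u * v = 1) :
    v ∈ 𝒜 (-p) := by
  obtain ⟨t, ht, htu⟩ :=
    exists_homogeneous_left_factor 𝒜 hu (SetLike.GradedOne.one_mem (A := 𝒜)) hvu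
  have : t = v := by rw [← mul_one t, ← huv, ← mul_assoc, htu, one_mul]
  rwa [← this, ← zero_sub]

/-- `ε` lies in the two-sided ideal generated by any nonzero element of `εA`. -/
def IdealSimple (F : Type u) [Field F] {A : Type w} [Ring A] [Algebra F A] (ε : A) : Prop :=
  ∀ x : A, ε * x = x → x ≠ 0 → ε ∈ Submodule.span F {y | ∃ s t, y = s * x * t}

variable {𝒜} {ε : A}

lemma IdealSimple.exists_homogeneous_mul_ne_zero (𝒜 : ι → Submodule F A) [GradedAlgebra 𝒜]
    (hs : IdealSimple F ε) {z x : A} (hx : ε * x = x)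
    (hx0 : x ≠ 0) (hz : z * ε = z) (hz0 : z ≠ 0) : ∃ p, ∃ c ∈ 𝒜 p, z * c * x ≠ 0 := by
  by_contra! h
  have h1 : ∀ c, z * c * x = 0 := by
    intro c
    induction c using DirectSum.Decomposition.inductionOn 𝒜 with
    | zero => simp
    | homogeneous m => exact h _ _ m.2
    | add a b ha hb => rw [mul_add, add_mul, ha, hb, add_zero]
  have h2 : ∀ y ∈ Submodule.span F {y | ∃ s t, y = s * x * t}, z * y = 0 := by
    intro y hy
    induction hy using Submodule.span_induction with
    | mem y hy =>
      obtain ⟨s, t, rfl⟩ := hy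
      rw [← mul_assoc, ← mul_assoc, h1, zero_mul]
    | zero => simp
    | add a b _ _ ha hb => rw [mul_add, ha, hb, add_zero]
    | smul c a _ ha => rw [mul_smul_comm, ha, smul_zero]
  exact hz0 (hz ▸ h2 ε (hs x hx hx0))

lemma exists_minimal_homogeneous [FiniteDimensional F A] (hε : ε ∈ 𝒜 0)
    (hε0 : ε ≠ 0) (hεε : ε * ε = ε) (hc : ∀ a, ε * a = a * ε) :
    ∃ q, ∃ x ∈ 𝒜 q, x ≠ 0 ∧ ε * x = x ∧ ∀ p, ∀ s ∈ 𝒜 p, s * x ≠ 0 → ∃ t, t * (s * x) = x := by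
  let S : Set (Submodule F A) :=
    {N | ∃ q, ∃ x ∈ 𝒜 q, x ≠ 0 ∧ ε * x = x ∧ N = LinearMap.range (LinearMap.mulRight F x)}
  obtain ⟨N, ⟨q, x, hx, hx0, hεx, rfl⟩, hmin⟩ :=
    (wellFounded_lt (α := Submodule F A)).has_min S ⟨_, 0, ε, hε, hε0, hεε, rfl⟩
  refine ⟨q, x, hx, hx0, hεx, fun p s hs hsx => ?_⟩
  have hle : LinearMap.range (LinearMap.mulRight F (s * x)) ≤
      LinearMap.range (LinearMap.mulRight F x) := by
    rintro _ ⟨y, rfl⟩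
    exact ⟨y * s, by simp [mul_assoc]⟩
  have hεsx : ε * (s * x) = s * x := by rw [← mul_assoc, hc, mul_assoc, hεx]
  have heq := hle.eq_of_not_lt
    (hmin _ ⟨p + q, s * x, SetLike.GradedMul.mul_mem hs hx, hsx, hεsx, rfl⟩)
  have hmem : x ∈ LinearMap.range (LinearMap.mulRight F x) := ⟨1, by simp⟩
  rw [← heq] at hmem
  obtain ⟨t, ht⟩ := hmem
  exact ⟨t, ht⟩

/-- `e` is a homogeneous idempotent of degree `0` whose corner `eAe` is a graded division
algebra. -/
structure IsDivisionIdempotent (𝒜 : ι → Submodule F A) (e : A) : Prop where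
  mem : e ∈ 𝒜 0
  ne_zero : e ≠ 0
  idem : e * e = e
  inv : ∀ p, ∀ d ∈ 𝒜 p, e * d = d → d * e = d → d ≠ 0 →
    ∃ d' ∈ 𝒜 (-p), e * d' = d' ∧ d' * e = d' ∧ d' * d = e ∧ d * d' = e

lemma exists_isDivisionIdempotent [FiniteDimensional F A] (hs : IdealSimple F ε)
    (hε : ε ∈ 𝒜 0) (hε0 : ε ≠ 0) (hεε : ε * ε = ε) (hc : ∀ a, ε * a = a * ε) :
    ∃ e, IsDivisionIdempotent 𝒜 e ∧ ε * e = e := by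
  obtain ⟨q, x, hx, hx0, hεx, hmin⟩ := exists_minimal_homogeneous hε hε0 hεε hc
  obtain ⟨p, c, hcp, hxcx⟩ := hs.exists_homogeneous_mul_ne_zero 𝒜 hεx hx0 (hc x ▸ hεx) hx0
  obtain ⟨t, ht⟩ := hmin (q + p) (x * c) (SetLike.GradedMul.mul_mem hx hcp) hxcx
  obtain ⟨y, hy, hyx⟩ := exists_homogeneous_left_factor 𝒜
    (SetLike.GradedMul.mul_mem (SetLike.GradedMul.mul_mem hx hcp) hx) hx ht
  have hcy : c * y ∈ 𝒜 (-q) := by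
    have := SetLike.GradedMul.mul_mem hcp hy
    convert this using 2
    abel
  have he : c * y * x ∈ 𝒜 0 := by
    simpa using SetLike.GradedMul.mul_mem hcy hx
  have hex : c * y * x * (c * x) = c * x := by
    conv_rhs => rw [← hyx]
    simp only [mul_assoc]
  have hcx0 : c * x ≠ 0 := fun h => hxcx (by rw [mul_assoc, h, mul_zero])
  set e := c * y * x with he_def
  clear_value e
  have he0 : e ≠ 0 := by
    intro h
    rw [h, zero_mul] at hex
    exact hcx0 hex.symm
  have hee : e * e = e := by
    by_contra h
    have hz : (e * (c * y) - c * y) * x ≠ 0 := by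
      rw [sub_mul, mul_assoc e, ← he_def]
      exact sub_ne_zero.mpr h
    have hmem : e * (c * y) - c * y ∈ 𝒜 (-q) :=
      sub_mem (by simpa using SetLike.GradedMul.mul_mem he hcy) hcy
    obtain ⟨t, ht⟩ := hmin _ _ hmem hz
    apply hxcx
    have h1 : (e * (c * y) - c * y) * x * (c * x) = 0 := by
      rw [sub_mul, mul_assoc e, ← he_def, sub_mul, mul_assoc e, hex, hex, sub_self]
    have h2 : t * ((e * (c * y) - c * y) * x) * (c * x) = 0 := by rw [mul_assoc, h1, mul_zero]
    rwa [ht, ← mul_assoc] at h2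
  have hleft : ∀ p, ∀ d ∈ 𝒜 p, e * d = d → d * e = d → d ≠ 0 →
      ∃ d' ∈ 𝒜 (-p), e * d' = d' ∧ d' * e = d' ∧ d' * d = e := by
    intro p d hd hed hde hd0
    have hdcy : d * (c * y) * x = d := by rw [mul_assoc, ← he_def, hde]
    obtain ⟨t, ht⟩ := hmin (p + -q) (d * (c * y)) (SetLike.GradedMul.mul_mem hd hcy)
      (by rwa [hdcy])
    rw [hdcy] at ht
    have ht' : c * y * t * d = e := by rw [mul_assoc, ht, he_def]
    obtain ⟨r, hr, hrd⟩ := exists_homogeneous_left_factor 𝒜 hd he ht'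
    refine ⟨e * r * e, ?_, ?_, ?_, ?_⟩
    · simpa using SetLike.GradedMul.mul_mem (SetLike.GradedMul.mul_mem he hr) he
    · rw [← mul_assoc, ← mul_assoc, hee]
    · rw [mul_assoc, hee]
    · rw [mul_assoc, hed, mul_assoc, hrd, hee]
  refine ⟨e, ⟨he, he0, hee, fun p d hd hed hde hd0 => ?_⟩, ?_⟩
  · obtain ⟨d', hd', h1, h2, h3⟩ := hleft p d hd hed hde hd0
    refine ⟨d', hd', h1, h2, h3, ?_⟩
    have hd'0 : d' ≠ 0 := by
      rintro rfl
      exact he0 (by rw [← h3, zero_mul])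
    obtain ⟨d'', -, -, h5, h6⟩ := hleft _ d' hd' h1 h2 hd'0
    have : d'' = d := by rw [← h5, ← h3, ← mul_assoc, h6, hed]
    rw [← this, h6]
  · rw [he_def, ← mul_assoc, hc, mul_assoc, hεx]

namespace IsDivisionIdempotent

variable {e : A}

/-- The support of the corner `eAe`. -/
def support (he : IsDivisionIdempotent 𝒜 e) : AddSubgroup ι where
  carrier := {p | ∃ d ∈ 𝒜 p, e * d = d ∧ d * e = d ∧ d ≠ 0}
  zero_mem' := ⟨e, he.mem, he.idem, he.idem, he.ne_zero⟩
  add_mem' := by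
    rintro p q ⟨d, hd, h1, h2, h3⟩ ⟨d', hd', h1', h2', h3'⟩
    refine ⟨d * d', SetLike.GradedMul.mul_mem hd hd', by rw [← mul_assoc, h1],
      by rw [mul_assoc, h2'], fun h => h3' ?_⟩
    obtain ⟨r, -, -, -, hr, -⟩ := he.inv p d hd h1 h2 h3
    rw [← h1', ← hr, mul_assoc, h, mul_zero]
  neg_mem' := by
    rintro p ⟨d, hd, h1, h2, h3⟩
    obtain ⟨r, hr, hr1, hr2, hr3, -⟩ := he.inv p d hd h1 h2 h3
    refine ⟨r, hr, hr1, hr2, ?_⟩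
    rintro rfl
    exact he.ne_zero (by rw [← hr3, zero_mul])

end IsDivisionIdempotent

/-- Homogeneous elements `a i`, `b i` of opposite degrees which split the idempotent `f` into
orthogonal idempotents `a i * b i` equivalent to `e`. -/
structure IsFrame (𝒜 : ι → Submodule F A) (e f : A) {I : Type*} [Fintype I] [DecidableEq I]
    (a b : I → A) (g : I → ι) : Prop where
  left_mem : ∀ i, a i ∈ 𝒜 (g i)
  right_mem : ∀ i, b i ∈ 𝒜 (-g i)
  left_mul : ∀ i, a i * e = a i
  mul_right : ∀ i, e * b i = b i
  mul_left : ∀ i, f * a i = a i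
  right_mul : ∀ i, b i * f = b i
  orth : ∀ i j, b i * a j = if i = j then e else 0
  sum_eq : ∑ i, a i * b i = f

omit [DecidableEq ι] [GradedAlgebra 𝒜] in
lemma IsFrame.reindex {e f : A} {I J : Type*} [Fintype I] [DecidableEq I] [Fintype J]
    [DecidableEq J] {a b : I → A} {g : I → ι} (h : IsFrame 𝒜 e f a b g) (σ : J ≃ I) :
    IsFrame 𝒜 e f (a ∘ σ) (b ∘ σ) (g ∘ σ) where
  left_mem _ := h.left_mem _
  right_mem _ := h.right_mem _
  left_mul _ := h.left_mul _
  mul_right _ := h.mul_right _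
  mul_left _ := h.mul_left _
  right_mul _ := h.right_mul _
  orth i j := by simp [h.orth]
  sum_eq := (Equiv.sum_comp σ fun i => a i * b i).trans h.sum_eq

/-- A homogeneous idempotent of `εA` splits off a copy of `e` in a prescribed degree class. -/
lemma exists_split (hs : IdealSimple F ε) (hc : ∀ a, ε * a = a * ε) {e : A}
    (he : IsDivisionIdempotent 𝒜 e) (hεe : ε * e = e) {f : A} (hf : f ∈ 𝒜 0) (hff : f * f = f)
    (hεf : ε * f = f) (hf0 : f ≠ 0) (s : ι → ι) (hs' : ∀ p, s p - p ∈ he.support) :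
    ∃ q a b, a ∈ 𝒜 (s q) ∧ b ∈ 𝒜 (-s q) ∧ a * e = a ∧ e * b = b ∧ f * a = a ∧ b * f = b ∧
      b * a = e := by
  obtain ⟨p, b, hb, hbf⟩ :=
    hs.exists_homogeneous_mul_ne_zero 𝒜 hεf hf0 ((hc e).symm.trans hεe) he.ne_zero
  obtain ⟨q, a, ha, hba⟩ := hs.exists_homogeneous_mul_ne_zero 𝒜 hεe he.ne_zero
    (z := e * b * f) (by rw [mul_assoc, ← hc f, hεf]) hbf
  have hd : e * b * f * a * e ∈ 𝒜 (p + q) := by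
    simpa using SetLike.GradedMul.mul_mem (SetLike.GradedMul.mul_mem (SetLike.GradedMul.mul_mem
      (SetLike.GradedMul.mul_mem he.mem hb) hf) ha) he.mem
  obtain ⟨d, hdm, hd1, hd2, hd3, -⟩ := he.inv _ _ hd (by simp only [← mul_assoc, he.idem])
    (by rw [mul_assoc, he.idem]) hba
  obtain ⟨w, hw, hw1, hw2, hw3⟩ := hs' q
  obtain ⟨w', hw', hw'1, hw'2, hw'3, -⟩ := he.inv _ _ hw hw1 hw2 hw3
  refine ⟨q, f * a * e * w, w' * (d * (e * b * f)), ?_, ?_, ?_, ?_, ?_, ?_, ?_⟩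
  · have := SetLike.GradedMul.mul_mem (SetLike.GradedMul.mul_mem (SetLike.GradedMul.mul_mem
      hf ha) he.mem) hw
    convert this using 2
    abel
  · have := SetLike.GradedMul.mul_mem hw' (SetLike.GradedMul.mul_mem hdm
      (SetLike.GradedMul.mul_mem (SetLike.GradedMul.mul_mem he.mem hb) hf))
    convert this using 2
    abel
  · rw [mul_assoc, hw2]
  · rw [← mul_assoc, hw'1]
  · simp only [← mul_assoc, hff]
  · simp only [mul_assoc, hff]
  · calc w' * (d * (e * b * f)) * (f * a * e * w)
        = w' * (d * (e * b * (f * f) * a * e)) * w := by simp only [mul_assoc]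
      _ = e := by rw [hff, hd3, hw'2, hw'3]

lemma exists_isFrame [FiniteDimensional F A] (hs : IdealSimple F ε)
    (hc : ∀ a, ε * a = a * ε) {e : A} (he : IsDivisionIdempotent 𝒜 e) (hεe : ε * e = e)
    (s : ι → ι) (hs' : ∀ p, s p - p ∈ he.support) (N : Submodule F A) :
    ∀ f ∈ 𝒜 0, f * f = f → ε * f = f → N = LinearMap.range (LinearMap.mulLeft F f) →
    ∃ (I : Type) (_ : Fintype I) (_ : DecidableEq I) (a b : I → A) (g : I → ι),
      IsFrame 𝒜 e f a b g ∧ ∀ i, g i ∈ Set.range s := by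
  induction N using (wellFounded_lt (α := Submodule F A)).induction with
  | _ N ih =>
  rintro f hf hff hεf rfl
  by_cases hf0 : f = 0
  · subst hf0
    refine ⟨Empty, inferInstance, inferInstance, Empty.elim, Empty.elim, Empty.elim, ?_, ?_⟩
    · constructor <;> simp
    · simp
  obtain ⟨q, a, b, ha, hb, hae, heb, hfa, hbf, hba⟩ :=
    exists_split hs hc he hεe hf hff hεf hf0 s hs'
  have hab : a * b ∈ 𝒜 0 := by simpa using SetLike.GradedMul.mul_mem ha hb
  have h1 : (f - a * b) * (f - a * b) = f - a * b := by
    have : a * b * (a * b) = a * b := by rw [mul_assoc, ← mul_assoc b, hba, heb]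
    rw [sub_mul, mul_sub, mul_sub, hff, this, ← mul_assoc, hfa, mul_assoc, hbf, sub_self, sub_zero]
  have hfa' : (f - a * b) * a = 0 := by rw [sub_mul, hfa, mul_assoc, hba, hae, sub_self]
  have hbf' : b * (f - a * b) = 0 := by rw [mul_sub, hbf, ← mul_assoc, hba, heb, sub_self]
  have ha0 : a ≠ 0 := by
    rintro rfl
    exact he.ne_zero (by rw [← hba, mul_zero])
  have hff' : f * (f - a * b) = f - a * b := by rw [mul_sub, hff, ← mul_assoc, hfa]
  have hf'f : (f - a * b) * f = f - a * b := by rw [sub_mul, hff, mul_assoc, hbf]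
  have hlt : LinearMap.range (LinearMap.mulLeft F (f - a * b)) <
      LinearMap.range (LinearMap.mulLeft F f) := by
    refine lt_of_le_of_ne ?_ fun h => ?_
    · rintro _ ⟨y, rfl⟩
      exact ⟨(f - a * b) * y, by simp only [LinearMap.mulLeft_apply, ← mul_assoc, hff']⟩
    · have : a ∈ LinearMap.range (LinearMap.mulLeft F f) := ⟨a, hfa⟩
      rw [← h] at this
      obtain ⟨y, hy⟩ := this
      rw [LinearMap.mulLeft_apply] at hy
      apply ha0
      rw [← hy, ← h1, mul_assoc, hy, hfa']
  obtain ⟨I, _, _, a', b', g, hfr, hg⟩ := ih _ hlt _ (sub_mem hf hab) h1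
    (by rw [mul_sub, hεf, ← mul_assoc, ← hfa, ← mul_assoc, hεf]) rfl
  refine ⟨Option I, inferInstance, inferInstance, fun i => i.elim a a', fun i => i.elim b b',
    fun i => i.elim (s q) g, ⟨?_, ?_, ?_, ?_, ?_, ?_, ?_, ?_⟩, ?_⟩
  · rintro (_ | i)
    exacts [ha, hfr.left_mem i]
  · rintro (_ | i)
    exacts [hb, hfr.right_mem i]
  · rintro (_ | i)
    exacts [hae, hfr.left_mul i]
  · rintro (_ | i)
    exacts [heb, hfr.mul_right i]
  · rintro (_ | i)
    · exact hfa
    · change f * a' i = a' i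
      rw [← hfr.mul_left i, ← mul_assoc, hff']
  · rintro (_ | i)
    · exact hbf
    · change b' i * f = b' i
      rw [← hfr.right_mul i, mul_assoc, hf'f]
  · rintro (_ | i) (_ | j)
    · simpa using hba
    · change b * a' j = _
      rw [← hfr.mul_left j, ← mul_assoc, hbf']
      simp
    · change b' i * a = _
      rw [← hfr.right_mul i, mul_assoc, hfa']
      simp
    · simpa using hfr.orth i j
  · simp [Fintype.sum_option, hfr.sum_eq]
  · rintro (_ | i)
    exacts [⟨q, rfl⟩, hg i]

end GradedStructure

section Corner

variable {A : Type w} [Ring A] [Algebra F A]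

/-- The elements of the corner `eAe` of an idempotent `e`. -/
def cornerSubmodule (F : Type u) [Field F] {A : Type w} [Ring A] [Algebra F A] (e : A) :
    Submodule F A where
  carrier := {x | e * x = x ∧ x * e = x}
  add_mem' := by
    rintro x y ⟨h1, h2⟩ ⟨h3, h4⟩
    exact ⟨by rw [mul_add, h1, h3], by rw [add_mul, h2, h4]⟩
  zero_mem' := by simp
  smul_mem' := by
    rintro c x ⟨h1, h2⟩
    exact ⟨by rw [mul_smul_comm, h1], by rw [smul_mul_assoc, h2]⟩

/-- The corner `eAe` of an idempotent `e`, as a type. -/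
def CornerAlg (F : Type u) [Field F] {A : Type w} [Ring A] [Algebra F A] (e : A)
    (_ : e * e = e) : Type w := cornerSubmodule F e

namespace CornerAlg

variable {e : A} {he : e * e = e}

instance : AddCommGroup (CornerAlg F e he) := inferInstanceAs (AddCommGroup (cornerSubmodule F e))

instance : Module F (CornerAlg F e he) := inferInstanceAs (Module F (cornerSubmodule F e))

/-- The inclusion of the corner. -/
def incl (F : Type u) [Field F] {A : Type w} [Ring A] [Algebra F A] (e : A) (he : e * e = e) :
    CornerAlg F e he →ₗ[F] A := (cornerSubmodule F e).subtype

lemma incl_injective : Function.Injective (incl F e he) := Subtype.val_injective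

/-- An element of the corner from an element fixed by `e` on both sides. -/
def mk {x : A} (h1 : e * x = x) (h2 : x * e = x) : CornerAlg F e he := ⟨x, h1, h2⟩

@[simp]
lemma incl_mk {x : A} (h1 : e * x = x) (h2 : x * e = x) :
    incl F e he (mk h1 h2) = x := rfl

lemma mul_incl (x : CornerAlg F e he) : e * incl F e he x = incl F e he x := x.2.1

lemma incl_mul (x : CornerAlg F e he) : incl F e he x * e = incl F e he x := x.2.2

instance : Mul (CornerAlg F e he) where
  mul x y := mk (x := incl F e he x * incl F e he y) (by rw [← mul_assoc, mul_incl])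
    (by rw [mul_assoc, incl_mul])

instance : One (CornerAlg F e he) where
  one := mk (x := e) he he

@[simp]
lemma incl_mul_eq (x y : CornerAlg F e he) :
    incl F e he (x * y) = incl F e he x * incl F e he y := rfl

@[simp]
lemma incl_one : incl F e he 1 = e := rfl

instance : Ring (CornerAlg F e he) where
  __ := (inferInstance : AddCommGroup (CornerAlg F e he))
  left_distrib x y z := incl_injective (by simp [mul_add])
  right_distrib x y z := incl_injective (by simp [add_mul])
  zero_mul x := incl_injective (by simp)
  mul_zero x := incl_injective (by simp)
  mul_assoc x y z := incl_injective (by simp [mul_assoc])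
  one_mul x := incl_injective (by simp [mul_incl])
  mul_one x := incl_injective (by simp [incl_mul])

instance : Algebra F (CornerAlg F e he) :=
  Algebra.ofModule (fun c x y => incl_injective (by simp))
    (fun c x y => incl_injective (by simp))

instance [FiniteDimensional F A] : FiniteDimensional F (CornerAlg F e he) :=
  inferInstanceAs (FiniteDimensional F (cornerSubmodule F e))

end CornerAlg

/-- The corner with the grading induced from a family of subspaces of `A`. -/
abbrev cornerGrAlg (Γ : ℤ × G → Submodule F A) {e : A} (he : e * e = e) :
    GrAlg.{u, v, w} F (ℤ × G) where
  carrier := CornerAlg F e he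
  gr p := (Γ p).comap (CornerAlg.incl F e he)

/-- The grading of an algebra by `ℤ × G`, as a graded algebra over the additive group. -/
@[reducible]
noncomputable def gradedAlgebraOf [DecidableEq G] (Γ : ℤ × G → Submodule F A)
    (hinternal : DirectSum.IsInternal Γ) (hone : (1 : A) ∈ Γ (0, 1))
    (hmul : ∀ p q : ℤ × G, ∀ x ∈ Γ p, ∀ y ∈ Γ q, x * y ∈ Γ (p.1 + q.1, p.2 * q.2)) :
    @GradedAlgebra (ℤ × Additive G) F A (inferInstanceAs (DecidableEq (ℤ × G))) _ _ _ _ Γ :=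
  letI : DecidableEq (ℤ × Additive G) := inferInstanceAs (DecidableEq (ℤ × G))
  { one_mem := hone
    mul_mem := fun p q _ _ hx hy => hmul p q _ hx _ hy
    toDecomposition := hinternal.chooseDecomposition }

lemma isGrading_cornerGrAlg [DecidableEq G] (Γ : ℤ × G → Submodule F A)
    (hinternal : DirectSum.IsInternal Γ)
    (hmul : ∀ p q : ℤ × G, ∀ x ∈ Γ p, ∀ y ∈ Γ q, x * y ∈ Γ (p.1 + q.1, p.2 * q.2))
    {e : A} (he : e * e = e) (hmem : e ∈ Γ (0, 1)) : IsGrading (cornerGrAlg Γ he) := by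
  rw [DirectSum.isInternal_submodule_iff_iSupIndep_and_iSup_eq_top] at hinternal
  obtain ⟨hind, hsup⟩ := hinternal
  refine ⟨?_, hmem, fun p q x hx y hy => hmul p q _ hx _ hy⟩
  rw [DirectSum.isInternal_submodule_iff_iSupIndep_and_iSup_eq_top]
  constructor
  · rw [iSupIndep_def] at hind ⊢
    intro p
    rw [Submodule.disjoint_def]
    intro (x : CornerAlg F e he) hx hx'
    apply CornerAlg.incl_injective
    rw [map_zero]
    refine (Submodule.disjoint_def.mp (hind p)) _ hx ?_
    have h := Submodule.mem_map_of_mem (f := CornerAlg.incl F e he) hx'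
    simp only [Submodule.map_iSup] at h
    exact iSup₂_mono (fun q _ => Submodule.map_comap_le (CornerAlg.incl F e he) (Γ q)) h
  · rw [eq_top_iff]
    rintro (x : CornerAlg F e he) -
    have key : ∀ y : A, ∀ h1 : e * (e * y * e) = e * y * e, ∀ h2 : e * y * e * e = e * y * e,
        (CornerAlg.mk h1 h2 : CornerAlg F e he) ∈ ⨆ p, (cornerGrAlg Γ he).gr p := by
      intro y
      have hy : y ∈ ⨆ p, Γ p := hsup ▸ Submodule.mem_top
      induction hy using Submodule.iSup_induction' with
      | mem p y hy =>
        intro h1 h2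
        refine Submodule.mem_iSup_of_mem p ?_
        change e * y * e ∈ Γ p
        simpa using hmul _ _ _ (hmul _ _ _ hmem _ hy) _ hmem
      | zero =>
        intro h1 h2
        convert Submodule.zero_mem _
        exact CornerAlg.incl_injective (by simp)
      | add a b _ _ ha hb =>
        intro h1 h2
        convert add_mem (ha (by simp only [← mul_assoc, he]) (by simp only [mul_assoc, he]))
          (hb (by simp only [← mul_assoc, he]) (by simp only [mul_assoc, he])) using 1
        exact CornerAlg.incl_injective (by
          rw [map_add, CornerAlg.incl_mk, CornerAlg.incl_mk, CornerAlg.incl_mk, mul_add, add_mul])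
    have hx : e * CornerAlg.incl F e he x * e = CornerAlg.incl F e he x := by
      rw [CornerAlg.mul_incl, CornerAlg.incl_mul]
    convert key (CornerAlg.incl F e he x) (by rw [hx, CornerAlg.mul_incl])
      (by rw [hx, CornerAlg.incl_mul])
    exact CornerAlg.incl_injective hx.symm

omit [CommGroup G] in
lemma isSimpleAlg_cornerGrAlg (Γ : ℤ × G → Submodule F A) {ε e : A} (hs : IdealSimple F ε)
    (he : e * e = e) (he0 : e ≠ 0) (hεe : ε * e = e) : IsSimpleAlg (cornerGrAlg Γ he) := by
  constructor
  · refine ⟨⟨(1 : CornerAlg F e he), (0 : CornerAlg F e he), fun h => he0 ?_⟩⟩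
    simpa using congrArg (CornerAlg.incl F e he) h
  · intro (K : Submodule F (CornerAlg F e he))
      (hK : ∀ a : CornerAlg F e he, ∀ x ∈ K, a * x ∈ K ∧ x * a ∈ K)
    by_contra! hcon
    obtain ⟨hbot, htop⟩ := hcon
    obtain ⟨x, hxK, hx0⟩ := Submodule.exists_mem_ne_zero_of_ne_bot hbot
    set y := CornerAlg.incl F e he x with hy
    have hy0 : y ≠ 0 := fun h => hx0 (CornerAlg.incl_injective (by rw [← hy, h, map_zero]))
    have hey : e * y = y := CornerAlg.mul_incl x
    have hye : y * e = y := CornerAlg.incl_mul x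
    have key : ∀ z ∈ Submodule.span F {z | ∃ s t, z = s * y * t},
        e * z * e ∈ K.map (CornerAlg.incl F e he) := by
      intro z hz
      induction hz using Submodule.span_induction with
      | mem z hz =>
        obtain ⟨s, t, rfl⟩ := hz
        let s' : CornerAlg F e he := CornerAlg.mk (x := e * s * e)
          (by simp only [← mul_assoc, he]) (by simp only [mul_assoc, he])
        let t' : CornerAlg F e he := CornerAlg.mk (x := e * t * e)
          (by simp only [← mul_assoc, he]) (by simp only [mul_assoc, he])
        refine ⟨s' * x * t', (hK t' _ (hK s' x hxK).1).2, ?_⟩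
        calc e * s * e * y * (e * t * e) = e * s * (e * y * e) * t * e := by
              simp only [mul_assoc]
          _ = e * (s * y * t) * e := by rw [hey, hye]; simp only [mul_assoc]
      | zero => simp
      | add a b _ _ ha hb => rw [mul_add, add_mul]; exact add_mem ha hb
      | smul c a _ ha => rw [mul_smul_comm, smul_mul_assoc]; exact Submodule.smul_mem _ _ ha
    have h1 := key ε (hs y (by rw [← hey, ← mul_assoc, hεe]) hy0)
    have h2 : e * ε * e = e := by rw [mul_assoc, hεe, he]
    rw [h2] at h1
    obtain ⟨k, hk, hke⟩ := h1
    have hk1 : k = (1 : CornerAlg F e he) := CornerAlg.incl_injective hke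
    apply htop
    rw [eq_top_iff]
    rintro z -
    have := (hK z k hk).1
    rw [hk1] at this
    rwa [mul_one] at this

lemma isGradedDivision_cornerGrAlg [DecidableEq G] [FiniteDimensional F A]
    (Γ : ℤ × G → Submodule F A) (hinternal : DirectSum.IsInternal Γ)
    (hmul : ∀ p q : ℤ × G, ∀ x ∈ Γ p, ∀ y ∈ Γ q, x * y ∈ Γ (p.1 + q.1, p.2 * q.2))
    {e : A} (he : IsDivisionIdempotent (ι := ℤ × Additive G) Γ e) :
    IsGradedDivision (cornerGrAlg Γ he.idem) := by
  refine ⟨isGrading_cornerGrAlg Γ hinternal hmul he.idem he.mem,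
    inferInstanceAs (FiniteDimensional F (CornerAlg F e he.idem)),
    fun p (x : CornerAlg F e he.idem) hx hx0 => ?_⟩
  obtain ⟨d, -, h1, h2, h3, h4⟩ := he.inv p _ hx (CornerAlg.mul_incl x) (CornerAlg.incl_mul x)
    fun h => hx0 (CornerAlg.incl_injective (h.trans (map_zero _).symm))
  let y : CornerAlg F e he.idem := CornerAlg.mk h1 h2
  have hxy : x * y = 1 := CornerAlg.incl_injective h4
  have hyx : y * x = 1 := CornerAlg.incl_injective h3
  exact ⟨⟨x, y, hxy, hyx⟩, rfl⟩

end Corner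

section ExchangeModel

variable {A : Type w} [Ring A] [Algebra F A]

/-- The exchange model attached to a frame for an idempotent `ε` with `φ ε = 1 - ε`. -/
def exchangeEquiv {φ : A →ₗ[F] A} (hφ₂ : ∀ a, φ (φ a) = a)
    (hφmul : ∀ a b, φ (a * b) = φ b * φ a) {ε e : A} (hεε : ε * ε = ε) (hφε : φ ε = 1 - ε)
    (he : e * e = e) {I : Type*} [Fintype I] [DecidableEq I] {a b : I → A}
    (hae : ∀ i, a i * e = a i) (heb : ∀ i, e * b i = b i) (hεa : ∀ i, ε * a i = a i)
    (hbε : ∀ i, b i * ε = b i) (horth : ∀ i j, b i * a j = if i = j then e else 0)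
    (hsum : ∑ i, a i * b i = ε) (hc : ∀ a, ε * a = a * ε) :
    A ≃ₐ[F] (Matrix I I (CornerAlg F e he) × (Matrix I I (CornerAlg F e he))ᵐᵒᵖ) :=
  let m : A → Matrix I I (CornerAlg F e he) := fun x => Matrix.of fun i j =>
    CornerAlg.mk (x := b i * x * a j) (by rw [← mul_assoc, ← mul_assoc, heb])
      (by rw [mul_assoc, hae])
  let t : Matrix I I (CornerAlg F e he) → A := fun X =>
    ∑ i, ∑ j, a i * CornerAlg.incl F e he (X i j) * b j
  have hmmul : ∀ x y, m (x * y) = m x * m y := by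
    intro x y
    ext i j
    apply CornerAlg.incl_injective
    rw [Matrix.mul_apply, map_sum]
    change b i * (x * y) * a j = ∑ k, b i * x * a k * (b k * y * a j)
    calc b i * (x * y) * a j = b i * ε * (x * y) * a j := by rw [hbε]
      _ = b i * x * ε * (y * a j) := by
        rw [mul_assoc (b i), ← mul_assoc ε, hc x]; simp only [mul_assoc]
      _ = _ := by
        rw [← hsum, Finset.mul_sum, Finset.sum_mul]
        simp only [mul_assoc]
  have hmadd : ∀ x y, m (x + y) = m x + m y := by
    intro x y
    ext i j
    apply CornerAlg.incl_injective
    rw [Matrix.add_apply, map_add]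
    change b i * (x + y) * a j = b i * x * a j + b i * y * a j
    rw [mul_add, add_mul]
  have hmalg : ∀ c : F, m (algebraMap F A c) = algebraMap F _ c := by
    intro c
    ext i j
    apply CornerAlg.incl_injective
    rw [Matrix.algebraMap_matrix_apply]
    change b i * algebraMap F A c * a j = _
    rw [← Algebra.commutes, mul_assoc, horth, Algebra.algebraMap_eq_smul_one,
      Algebra.algebraMap_eq_smul_one]
    split_ifs <;> simp
  have hmt : ∀ X, m (t X) = X := by
    intro X
    ext i j
    apply CornerAlg.incl_injective
    change b i * (∑ k, ∑ l, a k * CornerAlg.incl F e he (X k l) * b l) * a j = _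
    rw [Finset.mul_sum, Finset.sum_mul, Finset.sum_eq_single i, Finset.mul_sum, Finset.sum_mul,
      Finset.sum_eq_single j]
    · rw [mul_assoc, mul_assoc, horth, if_pos rfl, ← mul_assoc, ← mul_assoc, horth, if_pos rfl,
        CornerAlg.mul_incl, CornerAlg.incl_mul]
    · intro l _ hl
      rw [mul_assoc, mul_assoc, horth, if_neg hl, mul_zero, mul_zero]
    · simp
    · intro k _ hk
      rw [Finset.mul_sum, Finset.sum_mul]
      refine Finset.sum_eq_zero fun l _ => ?_
      rw [← mul_assoc, ← mul_assoc, horth, if_neg hk.symm, zero_mul, zero_mul, zero_mul]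
    · simp
  have htm : ∀ x, t (m x) = ε * x := by
    intro x
    change ∑ i, ∑ j, a i * (b i * x * a j) * b j = _
    have : ∀ i j, a i * (b i * x * a j) * b j = a i * b i * x * (a j * b j) := by
      intro i j
      simp only [mul_assoc]
    simp only [this]
    simp only [← Finset.mul_sum, ← Finset.sum_mul, hsum]
    rw [mul_assoc, ← hc, ← mul_assoc, hεε]
  have hεt : ∀ X, ε * t X = t X := by
    intro X
    simp only [t, Finset.mul_sum, ← mul_assoc, hεa]
  have hφt : ∀ X, ε * φ (t X) = 0 := by
    intro X
    rw [← hεt, hφmul, hc, mul_assoc, hφε, sub_mul, one_mul, hεε, sub_self, mul_zero]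
  have hm0 : ∀ x, ε * x = 0 → m x = 0 := by
    intro x hx
    ext i j
    apply CornerAlg.incl_injective
    change b i * x * a j = 0
    rw [← hbε, mul_assoc (b i), hx, mul_zero, zero_mul]
  have hφ1 : φ 1 = 1 := by
    have h := hφmul 1 (φ 1)
    rw [one_mul, hφ₂, one_mul] at h
    exact h.symm
  { toFun := fun x => (m x, MulOpposite.op (m (φ x)))
    invFun := fun Y => t Y.1 + φ (t Y.2.unop)
    left_inv := fun x => by
      simp only [htm, MulOpposite.unop_op, hφmul, hφ₂, hφε]
      rw [hc, ← mul_add, add_sub_cancel, mul_one]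
    right_inv := fun Y => by
      ext1
      · simp only [hmadd, hmt, hm0 _ (hφt _), add_zero]
      · simp only [map_add, hφ₂, hmadd, hmt, hm0 _ (hφt _), zero_add, MulOpposite.op_unop]
    map_mul' := fun x y => by
      simp only [hφmul, hmmul, Prod.mk_mul_mk, MulOpposite.op_mul]
    map_add' := fun x y => by
      simp only [map_add, hmadd, Prod.mk_add_mk, MulOpposite.op_add]
    commutes' := fun c => by
      have : φ (algebraMap F A c) = algebraMap F A c := by
        rw [Algebra.algebraMap_eq_smul_one, map_smul, hφ1]
      rw [this, hmalg]
      rfl }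

lemma map_exchangeEquiv {φ : A →ₗ[F] A} (hφ₂ : ∀ a, φ (φ a) = a)
    (hφmul : ∀ a b, φ (a * b) = φ b * φ a) {ε e : A} (hεε : ε * ε = ε) (hφε : φ ε = 1 - ε)
    (he : e * e = e) {I : Type*} [Fintype I] [DecidableEq I] {a b : I → A}
    (hae : ∀ i, a i * e = a i) (heb : ∀ i, e * b i = b i) (hεa : ∀ i, ε * a i = a i)
    (hbε : ∀ i, b i * ε = b i) (horth : ∀ i j, b i * a j = if i = j then e else 0)
    (hsum : ∑ i, a i * b i = ε) (hc : ∀ a, ε * a = a * ε) {Γ : ℤ × G → Submodule F A}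
    (hmul : ∀ p q : ℤ × G, ∀ x ∈ Γ p, ∀ y ∈ Γ q, x * y ∈ Γ (p.1 + q.1, p.2 * q.2))
    (hφgr : ∀ p : ℤ × G, Submodule.map φ (Γ p) = Γ (-p.1, p.2)) {δ : I → ℤ} {γ : I → G} {m : ℤ}
    (ha : ∀ i, a i ∈ Γ (m + δ i, γ i)) (hb : ∀ i, b i ∈ Γ (-(m + δ i), (γ i)⁻¹)) (p : ℤ × G) :
    Submodule.map (exchangeEquiv hφ₂ hφmul hεε hφε he hae heb hεa hbε horth hsum hc : A →ₗ[F] _)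
      (Γ p) = exGr (matGr (cornerGrAlg Γ he).gr γ δ) p := by
  have hφmem : ∀ p : ℤ × G, ∀ x ∈ Γ p, φ x ∈ Γ (-p.1, p.2) := fun p x hx =>
    hφgr p ▸ Submodule.mem_map_of_mem hx
  have hm : ∀ p : ℤ × G, ∀ x ∈ Γ p, ∀ i j,
      b i * x * a j ∈ Γ (p.1 - δ i + δ j, (γ i)⁻¹ * p.2 * γ j) := by
    intro p x hx i j
    convert hmul _ _ _ (hmul _ _ _ (hb i) _ hx) _ (ha j) using 3
    dsimp only
    ring
  have ht : ∀ p : ℤ × G, ∀ X ∈ matGr (cornerGrAlg Γ he).gr γ δ p,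
      ∑ i, ∑ j, a i * CornerAlg.incl F e he (X i j) * b j ∈ Γ p := by
    intro p X hX
    refine sum_mem fun i _ => sum_mem fun j _ => ?_
    convert hmul _ _ _ (hmul _ _ _ (ha i) _ (hX i j)) _ (hb j) using 2
    ext
    · dsimp only
      ring
    · dsimp only
      group
  apply le_antisymm
  · rintro _ ⟨x, hx, rfl⟩
    exact ⟨fun i j => hm p x hx i j, ⟨_, fun i j => hm (-p.1, p.2) _ (hφmem p x hx) i j, rfl⟩⟩
  · rintro Y ⟨hY1, Z, hZ, hZY⟩
    refine ⟨(exchangeEquiv hφ₂ hφmul hεε hφε he hae heb hεa hbε horth hsum hc).symm Y, ?_,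
      AlgEquiv.apply_symm_apply _ Y⟩
    refine add_mem (ht p _ hY1) ?_
    rw [← hZY]
    have := hφmem _ _ (ht _ _ hZ)
    simp only [neg_neg] at this
    exact this

end ExchangeModel

section GradedWedderburn

variable {A : Type w} [Ring A] [Algebra F A]

lemma decompose_mem_of_le_iSup {ι : Type*} [DecidableEq ι] {𝒜 : ι → Submodule F A}
    [DirectSum.Decomposition 𝒜] {N : Submodule F A} (hN : N ≤ ⨆ p, N ⊓ 𝒜 p) {x : A}
    (hx : x ∈ N) (q : ι) : (DirectSum.decompose 𝒜 x q : A) ∈ N := by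
  have key : ∀ y ∈ ⨆ p, N ⊓ 𝒜 p, (DirectSum.decompose 𝒜 y q : A) ∈ N := by
    intro y hy
    induction hy using Submodule.iSup_induction' with
    | mem p y hy =>
      by_cases hpq : p = q
      · subst hpq
        rw [DirectSum.decompose_of_mem_same 𝒜 hy.2]
        exact hy.1
      · rw [DirectSum.decompose_of_mem_ne 𝒜 hy.2 hpq]
        exact zero_mem _
    | zero => simp
    | add a b _ _ ha hb =>
      rw [DirectSum.decompose_add]
      exact add_mem ha hb
  exact key x (hN hx)

/-- A proper nonzero graded ideal of a simple algebra with involution is generated by a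
homogeneous central idempotent `ε` with `φ ε = 1 - ε`. -/
lemma exists_central_idempotent [DecidableEq G] (φ : A →ₗ[F] A) (hφ₂ : ∀ a, φ (φ a) = a)
    (hφmul : ∀ a b, φ (a * b) = φ b * φ a)
    (hsimple : ∀ I : Submodule F A,
      (∀ a : A, ∀ x ∈ I, a * x ∈ I ∧ x * a ∈ I) → (∀ x ∈ I, φ x ∈ I) → I = ⊥ ∨ I = ⊤)
    (Γ : ℤ × G → Submodule F A) (hinternal : DirectSum.IsInternal Γ) (hone : (1 : A) ∈ Γ (0, 1))
    (hφgr : ∀ p : ℤ × G, Submodule.map φ (Γ p) = Γ (-p.1, p.2))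
    (J : Submodule F A) (hJ : ∀ a : A, ∀ x ∈ J, a * x ∈ J ∧ x * a ∈ J)
    (hJgr : J ≤ ⨆ p, J ⊓ Γ p) (hJbot : J ≠ ⊥) (hJtop : J ≠ ⊤) :
    ∃ ε ∈ Γ (0, 1), ε ≠ 0 ∧ ε * ε = ε ∧ φ ε = 1 - ε ∧ (∀ a, ε * a = a * ε) ∧ IdealSimple F ε := by
  let _ := hinternal.chooseDecomposition
  have hK : ∀ I : Submodule F A, (∀ a : A, ∀ x ∈ I, a * x ∈ I ∧ x * a ∈ I) →
      ∀ a : A, ∀ x ∈ I.map φ, a * x ∈ I.map φ ∧ x * a ∈ I.map φ := by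
    rintro I hI a _ ⟨x, hx, rfl⟩
    exact ⟨⟨x * φ a, (hI _ x hx).2, by rw [hφmul, hφ₂]⟩, ⟨φ a * x, (hI _ x hx).1,
      by rw [hφmul, hφ₂]⟩⟩
  have hsup : ∀ I : Submodule F A, (∀ a : A, ∀ x ∈ I, a * x ∈ I ∧ x * a ∈ I) → I ≠ ⊥ →
      I ⊔ I.map φ = ⊤ := by
    intro I hI hI0
    refine (hsimple _ ?_ ?_).resolve_left fun h => hI0 (eq_bot_iff.mpr (h ▸ le_sup_left))
    · intro a x hx
      obtain ⟨y, hy, z, hz, rfl⟩ := Submodule.mem_sup.mp hx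
      rw [mul_add, add_mul]
      exact ⟨Submodule.add_mem_sup (hI a y hy).1 (hK I hI a z hz).1,
        Submodule.add_mem_sup (hI a y hy).2 (hK I hI a z hz).2⟩
    · intro x hx
      obtain ⟨y, hy, _, ⟨z, hz, rfl⟩, rfl⟩ := Submodule.mem_sup.mp hx
      rw [map_add, hφ₂, add_comm]
      exact Submodule.add_mem_sup hz (Submodule.mem_map_of_mem hy)
  have hinf : ∀ x, x ∈ J → x ∈ J.map φ → x = 0 := by
    have : J ⊓ J.map φ = ⊥ := by
      refine (hsimple _ ?_ ?_).resolve_right fun h => hJtop (eq_top_iff.mpr (h ▸ inf_le_left))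
      · rintro a x ⟨h1, h2⟩
        exact ⟨⟨(hJ a x h1).1, (hK J hJ a x h2).1⟩, ⟨(hJ a x h1).2, (hK J hJ a x h2).2⟩⟩
      · rintro x ⟨h1, y, hy, rfl⟩
        exact ⟨(hφ₂ y).symm ▸ hy, Submodule.mem_map_of_mem h1⟩
    intro x h1 h2
    have h3 : x ∈ J ⊓ J.map φ := ⟨h1, h2⟩
    rwa [this, Submodule.mem_bot] at h3
  have hφJgr : J.map φ ≤ ⨆ p, J.map φ ⊓ Γ p := by
    refine (Submodule.map_mono hJgr).trans ?_
    rw [Submodule.map_iSup]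
    refine iSup_le fun p => le_iSup_of_le (-p.1, p.2) (le_inf ?_ ?_)
    · exact Submodule.map_mono inf_le_left
    · exact hφgr p ▸ Submodule.map_mono inf_le_right
  obtain ⟨u, hu, v, hv, huv⟩ :=
    Submodule.mem_sup.mp ((hsup J hJ hJbot) ▸ Submodule.mem_top : (1 : A) ∈ J ⊔ J.map φ)
  set ε : A := ((DirectSum.decompose Γ u (0, 1) : Γ (0, 1)) : A) with hε
  have hεJ : ε ∈ J := decompose_mem_of_le_iSup hJgr hu _
  have hε' : 1 - ε ∈ J.map φ := by
    have h1 := congrArg (fun x => (DirectSum.decompose Γ x (0, 1) : A)) huv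
    simp only [DirectSum.decompose_add, DirectSum.add_apply, Submodule.coe_add,
      DirectSum.decompose_of_mem_same Γ hone] at h1
    rw [← h1, add_sub_cancel_left]
    exact decompose_mem_of_le_iSup hφJgr hv _
  have hright : ∀ x ∈ J, x * ε = x := by
    intro x hx
    have := hinf (x * (1 - ε)) (hJ _ x hx).2 (hK J hJ x _ hε').1
    rw [mul_sub, mul_one, sub_eq_zero] at this
    exact this.symm
  have hleft : ∀ x ∈ J, ε * x = x := by
    intro x hx
    have := hinf ((1 - ε) * x) (hJ _ x hx).1 (hK J hJ x _ hε').2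
    rw [sub_mul, one_mul, sub_eq_zero] at this
    exact this.symm
  have hφ0 : ∀ x ∈ J.map φ, ε * x = 0 := fun x hx =>
    hinf _ (hJ _ _ hεJ).2 (hK J hJ _ _ hx).1
  have hφ0' : ∀ x ∈ J.map φ, x * ε = 0 := fun x hx =>
    hinf _ (hJ _ _ hεJ).1 (hK J hJ _ _ hx).2
  have hφ1 : φ 1 = 1 := by
    have h := hφmul 1 (φ 1)
    rw [one_mul, hφ₂, one_mul] at h
    exact h.symm
  refine ⟨ε, SetLike.coe_mem _, ?_, hleft ε hεJ, ?_, ?_, ?_⟩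
  · intro h
    apply hJbot
    rw [eq_bot_iff]
    intro x hx
    rw [Submodule.mem_bot, ← hleft x hx, h, zero_mul]
  · obtain ⟨y, hy, hyε⟩ := hε'
    have h1 : φ (1 - ε) = y := by rw [← hyε, hφ₂]
    rw [map_sub, hφ1] at h1
    have h2 : ε * φ ε = 0 := hφ0 _ (Submodule.mem_map_of_mem hεJ)
    have h3 := hleft y hy
    rw [← h1, mul_sub, h2, sub_zero, mul_one] at h3
    exact (sub_eq_iff_eq_add.mpr (by rw [add_comm]; exact (sub_eq_iff_eq_add.mp h3.symm))).symm
  · intro a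
    rw [← hright _ (hJ a ε hεJ).2, mul_assoc]
    exact hleft _ (hJ a ε hεJ).1
  · intro x hx hx0
    set I := Submodule.span F {y | ∃ s t, y = s * x * t} with hI
    have hIideal : ∀ a : A, ∀ y ∈ I, a * y ∈ I ∧ y * a ∈ I := by
      intro a y hy
      induction hy using Submodule.span_induction with
      | mem y hy =>
        obtain ⟨s, t, rfl⟩ := hy
        exact ⟨Submodule.subset_span ⟨a * s, t, by simp only [mul_assoc]⟩,
          Submodule.subset_span ⟨s, t * a, by simp only [mul_assoc]⟩⟩
      | zero => simp
      | add b c _ _ hb hc =>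
        rw [mul_add, add_mul]
        exact ⟨add_mem hb.1 hc.1, add_mem hb.2 hc.2⟩
      | smul c b _ hb =>
        rw [mul_smul_comm, smul_mul_assoc]
        exact ⟨Submodule.smul_mem _ _ hb.1, Submodule.smul_mem _ _ hb.2⟩
    have hIJ : I ≤ J := by
      rw [hI, Submodule.span_le]
      rintro _ ⟨s, t, rfl⟩
      exact (hJ t _ (hJ s _ (hx ▸ (hJ x ε hεJ).2)).1).2
    have hI0 : I ≠ ⊥ := fun h => hx0 ((Submodule.eq_bot_iff _).mp h x
      (Submodule.subset_span ⟨1, 1, by simp⟩))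
    obtain ⟨i, hi, j, hj, hij⟩ :=
      Submodule.mem_sup.mp ((hsup I hIideal hI0) ▸ Submodule.mem_top : ε ∈ I ⊔ I.map φ)
    have h := congrArg (ε * ·) hij
    simp only [mul_add, hφ0 _ (Submodule.map_mono hIJ hj), add_zero, hleft _ hεJ] at h
    rw [← h]
    exact (hIideal ε i hi).1

lemma exists_sigma_equiv {X : Type*} [Finite X] {Y : Type*} (c : X → Y) :
    ∃ (k : ℕ) (γ : Fin k → Y) (κ : Fin k → ℕ) (σ : (Σ i, Fin (κ i)) ≃ X),
      (∀ i, 0 < κ i) ∧ Function.Injective γ ∧ ∀ y, c (σ y) = γ y.1 := by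
  obtain ⟨k, ⟨τ⟩⟩ := Finite.exists_equiv_fin (Set.range c)
  have h : ∀ i : Fin k, ∃ n, Nonempty ({x // c x = (τ.symm i : Y)} ≃ Fin n) :=
    fun i => Finite.exists_equiv_fin _
  choose κ hκ using h
  let ρ : ∀ i, Fin (κ i) ≃ {x // c x = (τ.symm i : Y)} := fun i => (hκ i).some.symm
  refine ⟨k, fun i => τ.symm i, κ, Equiv.ofBijective (fun y => (ρ y.1 y.2 : X)) ⟨?_, ?_⟩, ?_,
    Subtype.val_injective.comp τ.symm.injective, fun y => (ρ y.1 y.2).2⟩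
  · rintro ⟨i, r⟩ ⟨j, t⟩ h
    have hij : i = j := τ.symm.injective (Subtype.ext (by
      rw [← (ρ i r).2, ← (ρ j t).2]
      exact congrArg c h))
    subst hij
    exact Sigma.ext rfl (heq_of_eq ((ρ i).injective (Subtype.ext h)))
  · intro x
    have hx : c x = (τ.symm (τ ⟨c x, x, rfl⟩) : Y) := by rw [Equiv.symm_apply_apply]
    exact ⟨⟨τ ⟨c x, x, rfl⟩, (ρ _).symm ⟨x, hx⟩⟩, by simp⟩
  · intro i
    obtain ⟨x, hx⟩ := (τ.symm i).2
    exact Fin.pos ((ρ i).symm ⟨x, hx⟩)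

lemma exists_two_values {I : Type*} (d : I → ℤ) (h : ∀ i j, d i - d j ≤ 1)
    (hne : ∃ i j, d i ≠ d j) :
    ∃ m, (∀ i, d i = m ∨ d i = m + 1) ∧ (∃ i, d i = m) ∧ ∃ i, d i = m + 1 := by
  have key : ∃ i j, d i < d j := by
    obtain ⟨i, j, hij⟩ := hne
    rcases lt_or_gt_of_ne hij with hij | hij
    exacts [⟨i, j, hij⟩, ⟨j, i, hij⟩]
  obtain ⟨i, j, hij⟩ := key
  have h1 := h j i
  refine ⟨d i, fun l => ?_, ⟨i, rfl⟩, ⟨j, by omega⟩⟩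
  have h2 := h l i
  have h3 := h j l
  omega

omit [CommGroup G] in
/-- Indexing a finite family of degrees with two adjacent values in `ℤ` by `RepIdx`. -/
lemma exists_repIdx_equiv {I : Type*} [Finite I] (g : I → ℤ × G) {m : ℤ}
    (hm : ∀ i, (g i).1 = m ∨ (g i).1 = m + 1) (hm0 : ∃ i, (g i).1 = m)
    (hm1 : ∃ i, (g i).1 = m + 1) :
    ∃ (k₀ k₁ : ℕ) (γ₀ : Fin k₀ → G) (γ₁ : Fin k₁ → G) (κ₀ : Fin k₀ → ℕ) (κ₁ : Fin k₁ → ℕ)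
      (σ : RepIdx κ₀ κ₁ ≃ I), 1 ≤ k₀ ∧ 1 ≤ k₁ ∧ (∀ i, 0 < κ₀ i) ∧ (∀ i, 0 < κ₁ i) ∧
      Function.Injective γ₀ ∧ Function.Injective γ₁ ∧
      ∀ y, g (σ y) = (m + repDelta κ₀ κ₁ y, repGamma γ₀ γ₁ y) := by
  classical
  obtain ⟨k₀, γ₀, κ₀, σ₀, hκ₀, hγ₀, hσ₀⟩ :=
    exists_sigma_equiv fun x : {i // (g i).1 = m} => (g x).2
  obtain ⟨k₁, γ₁, κ₁, σ₁, hκ₁, hγ₁, hσ₁⟩ :=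
    exists_sigma_equiv fun x : {i // ¬ (g i).1 = m} => (g x).2
  refine ⟨k₀, k₁, γ₀, γ₁, κ₀, κ₁,
    (Equiv.sumCongr σ₀ σ₁).trans (Equiv.sumCompl fun i => (g i).1 = m), ?_, ?_, hκ₀, hκ₁, hγ₀,
    hγ₁, ?_⟩
  · obtain ⟨i, hi⟩ := hm0
    exact Fin.pos (σ₀.symm ⟨i, hi⟩).1
  · obtain ⟨i, hi⟩ := hm1
    exact Fin.pos (σ₁.symm ⟨i, by omega⟩).1
  · rintro (y | y)
    · refine Prod.ext ?_ (hσ₀ y)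
      exact (σ₀ y).2.trans (add_zero m).symm
    · refine Prod.ext ?_ (hσ₁ y)
      exact (hm _).resolve_left (σ₁ y).2

end GradedWedderburn

section FirstPart

variable {A : Type w} [Ring A] [Algebra F A]

/-- A homogeneous element of a graded division corner has `ℤ`-degree `0` when the `ℤ`-degrees
of `A` are bounded by `1` in absolute value. -/
lemma IsDivisionIdempotent.fst_eq_zero {Γ : ℤ × G → Submodule F A}
    (hmul : ∀ p q : ℤ × G, ∀ x ∈ Γ p, ∀ y ∈ Γ q, x * y ∈ Γ (p.1 + q.1, p.2 * q.2))
    (hsupp : ∀ p : ℤ × G, ∀ x ∈ Γ p, x ≠ 0 → p.1 = -1 ∨ p.1 = 0 ∨ p.1 = 1) {e : A}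
    (he : IsDivisionIdempotent (ι := ℤ × Additive G) Γ e) {p : ℤ × G} {d : A} (hd : d ∈ Γ p)
    (h1 : e * d = d) (h2 : d * e = d) (h0 : d ≠ 0) : p.1 = 0 := by
  obtain ⟨d', -, -, -, h3, -⟩ := he.inv p d hd h1 h2 h0
  have hdd : d * d ≠ 0 := by
    intro h
    apply h0
    rw [← h1, ← h3, mul_assoc, h, mul_zero]
  have := hsupp _ _ hd h0
  have := hsupp _ _ (hmul _ _ _ hd _ hd) hdd
  dsimp only at this
  omega

/-- In a frame for `ε`, two `ℤ`-degrees differ by at most `1`. -/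
lemma IsFrame.fst_sub_le {Γ : ℤ × G → Submodule F A}
    (hmul : ∀ p q : ℤ × G, ∀ x ∈ Γ p, ∀ y ∈ Γ q, x * y ∈ Γ (p.1 + q.1, p.2 * q.2))
    (hsupp : ∀ p : ℤ × G, ∀ x ∈ Γ p, x ≠ 0 → p.1 = -1 ∨ p.1 = 0 ∨ p.1 = 1) {e f : A}
    (he : IsDivisionIdempotent (ι := ℤ × Additive G) Γ e) {I : Type*} [Fintype I]
    [DecidableEq I] {a b : I → A} {g : I → ℤ × Additive G}
    (h : IsFrame (ι := ℤ × Additive G) Γ e f a b g) (i j : I) : (g i).1 - (g j).1 ≤ 1 := by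
  have h0 : a i * b j ≠ 0 := by
    intro h0
    apply he.ne_zero
    have h1 : b i * (a i * b j) * a j = e := by
      rw [mul_assoc, mul_assoc, h.orth, if_pos rfl, ← mul_assoc, h.orth, if_pos rfl, he.idem]
    rw [← h1, h0, mul_zero, zero_mul]
  have := hsupp _ _ (hmul _ _ _ (h.left_mem i) _ (h.right_mem j)) h0
  dsimp only [Prod.fst_neg] at this
  omega

/-- A frame for `ε` has two different `ℤ`-degrees as soon as `εA` has a nonzero homogeneous
element of nonzero `ℤ`-degree. -/
lemma IsFrame.exists_fst_ne {Γ : ℤ × G → Submodule F A}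
    (hmul : ∀ p q : ℤ × G, ∀ x ∈ Γ p, ∀ y ∈ Γ q, x * y ∈ Γ (p.1 + q.1, p.2 * q.2))
    (hsupp : ∀ p : ℤ × G, ∀ x ∈ Γ p, x ≠ 0 → p.1 = -1 ∨ p.1 = 0 ∨ p.1 = 1) {e ε : A}
    (he : IsDivisionIdempotent (ι := ℤ × Additive G) Γ e) {I : Type*} [Fintype I]
    [DecidableEq I] {a b : I → A} {g : I → ℤ × Additive G}
    (h : IsFrame (ι := ℤ × Additive G) Γ e ε a b g) (hc : ∀ a, ε * a = a * ε)
    (hεε : ε * ε = ε) {p : ℤ × G} (hp : p.1 ≠ 0) {x : A} (hx : x ∈ Γ p) (hx0 : ε * x ≠ 0) :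
    ∃ i j, (g i).1 ≠ (g j).1 := by
  have key : ∃ i j, b i * x * a j ≠ 0 := by
    by_contra! hcon
    apply hx0
    calc ε * x = ε * x * ε := by rw [mul_assoc, ← hc, ← mul_assoc, hεε]
      _ = ∑ i, ∑ j, a i * (b i * x * a j) * b j := by
        rw [← h.sum_eq, Finset.sum_mul, Finset.sum_mul]
        simp only [Finset.mul_sum, mul_assoc]
      _ = 0 := by simp only [hcon, mul_zero, zero_mul, Finset.sum_const_zero]
  obtain ⟨i, j, hij⟩ := key
  refine ⟨i, j, fun hg => hp ?_⟩
  have := he.fst_eq_zero hmul hsupp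
    (hmul _ _ _ (hmul _ _ _ (h.right_mem i) _ hx) _ (h.left_mem j))
    (by rw [← mul_assoc, ← mul_assoc, h.mul_right]) (by rw [mul_assoc, h.left_mul]) hij
  dsimp only [Prod.fst_neg] at this
  omega

/-- Classification of simple algebras with involution and a degree-inverting `ℤ × G`-grading
that are not graded-simple. -/
theorem exists_exchange_model [DecidableEq G] [FiniteDimensional F A] (φ : A →ₗ[F] A)
    (hφ₂ : ∀ a, φ (φ a) = a) (hφmul : ∀ a b, φ (a * b) = φ b * φ a)
    (hsimple : ∀ I : Submodule F A,
      (∀ a : A, ∀ x ∈ I, a * x ∈ I ∧ x * a ∈ I) → (∀ x ∈ I, φ x ∈ I) → I = ⊥ ∨ I = ⊤)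
    (Γ : ℤ × G → Submodule F A) (hinternal : DirectSum.IsInternal Γ) (hone : (1 : A) ∈ Γ (0, 1))
    (hmul : ∀ p q : ℤ × G, ∀ x ∈ Γ p, ∀ y ∈ Γ q, x * y ∈ Γ (p.1 + q.1, p.2 * q.2))
    (hφgr : ∀ p : ℤ × G, Submodule.map φ (Γ p) = Γ (-p.1, p.2))
    (hsupp : ∀ p : ℤ × G, Γ p ≠ ⊥ → p.1 = -1 ∨ p.1 = 0 ∨ p.1 = 1) (hsupp₁ : ∃ g : G, Γ (1, g) ≠ ⊥)
    {J : Submodule F A} (hJ : ∀ a : A, ∀ x ∈ J, a * x ∈ J ∧ x * a ∈ J)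
    (hJgr : J ≤ ⨆ p, J ⊓ Γ p) (hJbot : J ≠ ⊥) (hJtop : J ≠ ⊤) :
    ∃ (D : GrAlg.{u, v, w} F (ℤ × G)) (k₀ k₁ : ℕ) (γ₀ : Fin k₀ → G) (γ₁ : Fin k₁ → G)
        (κ₀ : Fin k₀ → ℕ) (κ₁ : Fin k₁ → ℕ),
      IsGradedDivision D ∧ IsSimpleAlg D ∧ 1 ≤ k₀ ∧ 1 ≤ k₁ ∧
      (∀ i, 0 < κ₀ i) ∧ (∀ i, 0 < κ₁ i) ∧
      (∀ i j : Fin k₀, D.gr (0, (γ₀ i)⁻¹ * γ₀ j) ≠ ⊥ → i = j) ∧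
      (∀ i j : Fin k₁, D.gr (0, (γ₁ i)⁻¹ * γ₁ j) ≠ ⊥ → i = j) ∧
      ∃ e : A ≃ₐ[F]
          (Matrix (RepIdx κ₀ κ₁) (RepIdx κ₀ κ₁) D.carrier ×
            (Matrix (RepIdx κ₀ κ₁) (RepIdx κ₀ κ₁) D.carrier)ᵐᵒᵖ),
        (∀ x : A, e (φ x) = exInv F (Matrix (RepIdx κ₀ κ₁) (RepIdx κ₀ κ₁) D.carrier) (e x)) ∧
        (∀ p : ℤ × G, Submodule.map (e : A →ₗ[F] _) (Γ p)
          = exGr (matGr D.gr (repGamma γ₀ γ₁) (repDelta κ₀ κ₁)) p) := by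
  obtain ⟨ε, hε, hε0, hεε, hφε, hc, hs⟩ := exists_central_idempotent φ hφ₂ hφmul hsimple Γ
    hinternal hone hφgr J hJ hJgr hJbot hJtop
  have hsupp' : ∀ p : ℤ × G, ∀ x ∈ Γ p, x ≠ 0 → p.1 = -1 ∨ p.1 = 0 ∨ p.1 = 1 :=
    fun p x hx hx0 => hsupp p fun h => hx0 ((Submodule.eq_bot_iff _).mp h x hx)
  let _ : DecidableEq (ℤ × Additive G) := inferInstanceAs (DecidableEq (ℤ × G))
  let _ : GradedAlgebra (ι := ℤ × Additive G) Γ := gradedAlgebraOf Γ hinternal hone hmul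
  obtain ⟨e, he, hεe⟩ :=
    exists_isDivisionIdempotent (ι := ℤ × Additive G) (𝒜 := Γ) hs hε hε0 hεε hc
  let s : ℤ × Additive G → ℤ × Additive G := fun p => (p : (ℤ × Additive G) ⧸ he.support).out
  have hs' : ∀ p, s p - p ∈ he.support := fun p => by
    rw [← neg_add_eq_sub]
    exact QuotientAddGroup.eq.mp (QuotientAddGroup.out_eq' _).symm
  obtain ⟨I, _, _, a, b, g, hfr, hg⟩ := exists_isFrame hs hc he hεe s hs' _ ε hε hεε hεε rfl
  have hdist : ∀ i j, ∀ x ∈ Γ (-(g i) + g j), e * x = x → x * e = x → x ≠ 0 → g i = g j := by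
    intro i j x hx h1 h2 h0
    have hmem : -(g i) + g j ∈ he.support := ⟨x, hx, h1, h2, h0⟩
    obtain ⟨p, hp⟩ := hg i
    obtain ⟨q, hq⟩ := hg j
    have h3 := QuotientAddGroup.eq.mpr hmem
    rw [← hp, ← hq, QuotientAddGroup.out_eq', QuotientAddGroup.out_eq'] at h3
    rw [← hp, ← hq]
    exact congrArg Quotient.out h3
  have hne : ∃ i j, (g i).1 ≠ (g j).1 := by
    obtain ⟨c, hc1⟩ := hsupp₁
    obtain ⟨x, hx, hx0⟩ := Submodule.exists_mem_ne_zero_of_ne_bot hc1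
    by_cases h : ε * x = 0
    · refine hfr.exists_fst_ne hmul hsupp' he hc hεε (p := (-1, c)) (x := φ x) (by simp)
        (hφgr (1, c) ▸ Submodule.mem_map_of_mem hx) fun h' => hx0 ?_
      have h'' := congrArg φ h'
      rw [hφmul, hφ₂, hφε, map_zero, mul_sub, mul_one, ← hc, h, sub_zero] at h''
      exact h''
    · exact hfr.exists_fst_ne hmul hsupp' he hc hεε (p := (1, c)) (by simp) hx h
  obtain ⟨m, hm, hm0, hm1⟩ :=
    exists_two_values (fun i => (g i).1) (hfr.fst_sub_le hmul hsupp' he) hne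
  obtain ⟨k₀, k₁, γ₀, γ₁, κ₀, κ₁, σ, hk₀, hk₁, hκ₀, hκ₁, hγ₀, hγ₁, hσ⟩ :=
    exists_repIdx_equiv (G := G) g hm hm0 hm1
  have hfr' := hfr.reindex σ
  have hdist' : ∀ y z : RepIdx κ₀ κ₁, repDelta κ₀ κ₁ y = repDelta κ₀ κ₁ z →
      (cornerGrAlg Γ he.idem).gr (0, (repGamma γ₀ γ₁ y)⁻¹ * repGamma γ₀ γ₁ z) ≠ ⊥ →
      repGamma γ₀ γ₁ y = repGamma γ₀ γ₁ z := by
    intro y z hyz hbot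
    obtain ⟨x, hx, hx0⟩ := Submodule.exists_mem_ne_zero_of_ne_bot hbot
    have hdeg : -(g (σ y)) + g (σ z) = ((0, (repGamma γ₀ γ₁ y)⁻¹ * repGamma γ₀ γ₁ z) : ℤ × G) := by
      rw [hσ, hσ, hyz]
      exact Prod.ext (neg_add_cancel _) rfl
    have h := hdist (σ y) (σ z) (CornerAlg.incl F e he.idem x) (hdeg ▸ hx) (CornerAlg.mul_incl x)
      (CornerAlg.incl_mul x) fun h => hx0 (CornerAlg.incl_injective (h.trans (map_zero _).symm))
    rw [hσ, hσ] at h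
    exact congrArg Prod.snd h
  refine ⟨cornerGrAlg Γ he.idem, k₀, k₁, γ₀, γ₁, κ₀, κ₁,
    isGradedDivision_cornerGrAlg Γ hinternal hmul he,
    isSimpleAlg_cornerGrAlg Γ hs he.idem he.ne_zero hεe, hk₀, hk₁, hκ₀, hκ₁, ?_, ?_,
    exchangeEquiv hφ₂ hφmul hεε hφε he.idem hfr'.left_mul hfr'.mul_right hfr'.mul_left
      hfr'.right_mul hfr'.orth hfr'.sum_eq hc, ?_, ?_⟩
  · intro i j hij
    exact hγ₀ (hdist' (Sum.inl ⟨i, 0, hκ₀ i⟩) (Sum.inl ⟨j, 0, hκ₀ j⟩) rfl hij)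
  · intro i j hij
    exact hγ₁ (hdist' (Sum.inr ⟨i, 0, hκ₁ i⟩) (Sum.inr ⟨j, 0, hκ₁ j⟩) rfl hij)
  · intro x
    change (_, MulOpposite.op _) = (_, MulOpposite.op _)
    simp only [hφ₂]
    rfl
  · intro p
    refine map_exchangeEquiv hφ₂ hφmul hεε hφε he.idem _ _ _ _ _ _ hc hmul hφgr (m := m) ?_ ?_ p
    · intro y
      exact hσ y ▸ hfr'.left_mem y
    · intro y
      have := hfr'.right_mem y
      rw [Function.comp_apply (f := g), hσ y] at this
      exact this

end FirstPart

section Isomorphisms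

/-- Functions on finite types with the same multiset of values differ by a bijection. -/
lemma exists_equiv_of_map_univ_eq {X Y Z : Type*} [Fintype X] [Fintype Y] {f : X → Z} {g : Y → Z}
    (h : (Finset.univ.val : Multiset X).map f = (Finset.univ.val : Multiset Y).map g) :
    ∃ σ : X ≃ Y, ∀ x, f x = g (σ x) := by
  classical
  have hcard : ∀ z, Fintype.card {x // f x = z} = Fintype.card {y // g y = z} := by
    intro z
    have hz := congrArg (Multiset.count z) h
    rw [Multiset.count_map, Multiset.count_map] at hz
    rw [Fintype.card_subtype, Fintype.card_subtype]
    simpa only [Finset.card, Finset.filter_val, eq_comm] using hz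
  refine ⟨Equiv.ofFiberEquiv fun z => Fintype.equivOfCardEq (hcard z), fun x => ?_⟩
  exact (Equiv.ofFiberEquiv_map _ x).symm

lemma exists_repIdx_equiv_of_xi_eq {T : Subgroup G} {g : G} {k₀ k₁ k₀' k₁' : ℕ}
    {γ₀ : Fin k₀ → G} {γ₁ : Fin k₁ → G} {γ₀' : Fin k₀' → G} {γ₁' : Fin k₁' → G}
    {κ₀ : Fin k₀ → ℕ} {κ₁ : Fin k₁ → ℕ} {κ₀' : Fin k₀' → ℕ} {κ₁' : Fin k₁' → ℕ}
    (h₀ : Xi T 1 κ₀ γ₀ = Xi T g κ₀' γ₀') (h₁ : Xi T 1 κ₁ γ₁ = Xi T g κ₁' γ₁') :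
    ∃ σ : RepIdx κ₀ κ₁ ≃ RepIdx κ₀' κ₁', ∀ i, repDelta κ₀' κ₁' (σ i) = repDelta κ₀ κ₁ i ∧
      (repGamma γ₀ γ₁ i)⁻¹ * (g * repGamma γ₀' γ₁' (σ i)) ∈ T := by
  obtain ⟨σ₀, hσ₀⟩ := exists_equiv_of_map_univ_eq h₀
  obtain ⟨σ₁, hσ₁⟩ := exists_equiv_of_map_univ_eq h₁
  simp only [one_mul] at hσ₀ hσ₁
  refine ⟨Equiv.sumCongr σ₀ σ₁, ?_⟩
  rintro (i | i)
  · exact ⟨rfl, QuotientGroup.eq.mp (hσ₀ i)⟩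
  · exact ⟨rfl, QuotientGroup.eq.mp (hσ₁ i)⟩

variable {D C : Type w} [Ring D] [Algebra F D] [Ring C] [Algebra F C]

/-- Conjugation of matrices by a diagonal matrix of units. -/
def diagonalConj (F : Type u) [Field F] {D : Type w} [Ring D] [Algebra F D] {I : Type*} [Fintype I]
    [DecidableEq I] (v : I → Dˣ) : Matrix I I D ≃ₐ[F] Matrix I I D where
  toFun X := Matrix.of fun i j => ↑(v i)⁻¹ * X i j * v j
  invFun X := Matrix.of fun i j => v i * X i j * ↑(v j)⁻¹
  left_inv X := by
    ext i j
    simp [mul_assoc]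
  right_inv X := by
    ext i j
    simp [mul_assoc]
  map_mul' X Y := by
    ext i j
    simp [Matrix.mul_apply, Finset.mul_sum, Finset.sum_mul, mul_assoc]
  map_add' X Y := by
    ext i j
    simp [mul_add, add_mul]
  commutes' c := by
    ext i j
    rw [Matrix.of_apply, Matrix.algebraMap_matrix_apply]
    split_ifs with h
    · rw [h, mul_assoc, Algebra.commutes, Units.inv_mul_cancel_left]
    · simp

/-- A graded isomorphism of coefficient algebras and a matching of degrees up to homogeneous units
give a graded isomorphism of matrix algebras. -/
lemma exists_graded_matrix_equiv {Dgr : ℤ × G → Submodule F D} {Cgr : ℤ × G → Submodule F C}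
    (hmul : ∀ p q : ℤ × G, ∀ x ∈ Dgr p, ∀ y ∈ Dgr q, x * y ∈ Dgr (p.1 + q.1, p.2 * q.2))
    (f : D ≃ₐ[F] C) (hf : ∀ p x, f x ∈ Cgr p ↔ x ∈ Dgr p) {I I' : Type*} [Fintype I]
    [DecidableEq I] [Fintype I'] [DecidableEq I'] (σ : I ≃ I') {γ : I → G} {γ' : I' → G}
    {δ : I → ℤ} {δ' : I' → ℤ} (hδ : ∀ i, δ' (σ i) = δ i) {g : G} (v : I → Dˣ)
    (hv : ∀ i, (v i : D) ∈ Dgr (0, (γ i)⁻¹ * (g * γ' (σ i))))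
    (hv' : ∀ i, ((v i)⁻¹ : Dˣ).val ∈ Dgr (0, ((γ i)⁻¹ * (g * γ' (σ i)))⁻¹)) :
    ∃ ψ : Matrix I I D ≃ₐ[F] Matrix I' I' C,
      ∀ p X, ψ X ∈ matGr Cgr γ' δ' p ↔ X ∈ matGr Dgr γ δ p := by
  refine ⟨((diagonalConj F v).trans f.mapMatrix).trans (Matrix.reindexAlgEquiv F C σ),
    fun p X => ?_⟩
  have key : ∀ i j, f (↑(v i)⁻¹ * X i j * v j) ∈
        Cgr (p.1 - δ' (σ i) + δ' (σ j), (γ' (σ i))⁻¹ * p.2 * γ' (σ j)) ↔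
      X i j ∈ Dgr (p.1 - δ i + δ j, (γ i)⁻¹ * p.2 * γ j) := by
    intro i j
    rw [hf, hδ, hδ]
    constructor
    · intro h
      convert hmul _ _ _ (hmul _ _ _ (hv i) _ h) _ (hv' j) using 1
      · congr 1
        refine Prod.ext (by dsimp only; ring) (Additive.ofMul.injective ?_)
        simp only [ofMul_mul, ofMul_inv]
        abel
      · simp [mul_assoc]
    · intro h
      convert hmul _ _ _ (hmul _ _ _ (hv' i) _ h) _ (hv j) using 2
      refine Prod.ext (by dsimp only; ring) (Additive.ofMul.injective ?_)
      simp only [ofMul_mul, ofMul_inv]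
      abel
  constructor
  · intro h i j
    have := h (σ i) (σ j)
    rw [← key]
    simpa [Matrix.reindexAlgEquiv, diagonalConj] using this
  · intro h i' j'
    obtain ⟨i, rfl⟩ := σ.surjective i'
    obtain ⟨j, rfl⟩ := σ.surjective j'
    have := (key i j).mpr (h i j)
    simpa [Matrix.reindexAlgEquiv, diagonalConj] using this

lemma exists_homogeneous_units [DecidableEq G] {D : GrAlg.{u, v, w} F (ℤ × G)}
    (hD : IsGradedDivision D) {g : G} (hg : D.gr (0, g) ≠ ⊥) :
    ∃ u : D.carrierˣ, (u : D.carrier) ∈ D.gr (0, g) ∧ (u⁻¹ : D.carrierˣ).val ∈ D.gr (0, g⁻¹) := by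
  obtain ⟨⟨hint, hone, hmul⟩, -, hunit⟩ := hD
  obtain ⟨x, hx, hx0⟩ := Submodule.exists_mem_ne_zero_of_ne_bot hg
  obtain ⟨u, rfl⟩ := hunit _ x hx hx0
  refine ⟨u, hx, ?_⟩
  let _ : DecidableEq (ℤ × Additive G) := inferInstanceAs (DecidableEq (ℤ × G))
  let _ : GradedAlgebra (ι := ℤ × Additive G) D.gr := gradedAlgebraOf D.gr hint hone hmul
  exact inverse_homogeneous (ι := ℤ × Additive G) D.gr hx u.inv_mul u.mul_inv

lemma AlgEquiv.map_eq_of_mem_iff {A B : Type*} [Ring A] [Algebra F A] [Ring B] [Algebra F B]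
    (f : A ≃ₐ[F] B) {M : Submodule F A} {N : Submodule F B} (h : ∀ x, f x ∈ N ↔ x ∈ M) :
    M.map (f : A →ₗ[F] B) = N := by
  ext y
  obtain ⟨x, rfl⟩ := f.surjective y
  rw [h]
  exact ⟨fun ⟨z, hz, hzx⟩ => f.injective hzx ▸ hz, fun hx => ⟨x, hx, rfl⟩⟩

lemma AlgEquiv.mem_iff_of_map_eq {A B : Type*} [Ring A] [Algebra F A] [Ring B] [Algebra F B]
    (f : A ≃ₐ[F] B) {M : Submodule F A} {N : Submodule F B} (h : M.map (f : A →ₗ[F] B) = N)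
    (x : A) : f x ∈ N ↔ x ∈ M := by
  rw [← h]
  exact ⟨fun ⟨z, hz, hzx⟩ => f.injective hzx ▸ hz, fun hx => ⟨x, hx, rfl⟩⟩

omit [CommGroup G] in
lemma mem_opGr {Γ : ℤ × G → Submodule F D} {p : ℤ × G} {x : Dᵐᵒᵖ} :
    x ∈ opGr Γ p ↔ x.unop ∈ Γ (-p.1, p.2) :=
  ⟨fun ⟨_, hy, hyx⟩ => hyx ▸ hy, fun hx => ⟨_, hx, rfl⟩⟩

omit [CommGroup G] in
lemma mem_exGr {Γ : ℤ × G → Submodule F D} {p : ℤ × G} {x : D × Dᵐᵒᵖ} :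
    x ∈ exGr Γ p ↔ x.1 ∈ Γ p ∧ x.2.unop ∈ Γ (-p.1, p.2) :=
  and_congr_right fun _ => mem_opGr

omit [CommGroup G] in
/-- A graded isomorphism `B ≅ C` induces an isomorphism of the exchange algebras. -/
lemma exists_exchange_equiv {B C : Type*} [Ring B] [Algebra F B] [Ring C] [Algebra F C]
    {Γ : ℤ × G → Submodule F B} {Γ' : ℤ × G → Submodule F C} (ψ : B ≃ₐ[F] C)
    (hψ : ∀ p x, ψ x ∈ Γ' p ↔ x ∈ Γ p) :
    ∃ e : (B × Bᵐᵒᵖ) ≃ₐ[F] (C × Cᵐᵒᵖ), (∀ x, e (exInv F B x) = exInv F C (e x)) ∧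
      ∀ p, Submodule.map (e : (B × Bᵐᵒᵖ) →ₗ[F] (C × Cᵐᵒᵖ)) (exGr Γ p) = exGr Γ' p := by
  refine ⟨AlgEquiv.prodCongr ψ (AlgEquiv.op ψ), fun x => rfl, fun p => ?_⟩
  refine AlgEquiv.map_eq_of_mem_iff _ fun x => ?_
  rw [mem_exGr, mem_exGr]
  exact and_congr (hψ _ _) (hψ _ _)

omit [CommGroup G] in
/-- A graded isomorphism `B ≅ Cᵐᵒᵖ` induces an isomorphism of the exchange algebras. -/
lemma exists_exchange_equiv_of_op {B C : Type*} [Ring B] [Algebra F B] [Ring C] [Algebra F C]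
    {Γ : ℤ × G → Submodule F B} {Γ' : ℤ × G → Submodule F C} (ψ : B ≃ₐ[F] Cᵐᵒᵖ)
    (hψ : ∀ p x, ψ x ∈ opGr Γ' p ↔ x ∈ Γ p) :
    ∃ e : (B × Bᵐᵒᵖ) ≃ₐ[F] (C × Cᵐᵒᵖ), (∀ x, e (exInv F B x) = exInv F C (e x)) ∧
      ∀ p, Submodule.map (e : (B × Bᵐᵒᵖ) →ₗ[F] (C × Cᵐᵒᵖ)) (exGr Γ p) = exGr Γ' p := by
  let swap : (Cᵐᵒᵖ × C) ≃ₐ[F] (C × Cᵐᵒᵖ) :=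
    AlgEquiv.ofRingEquiv (f := RingEquiv.prodComm) fun _ => rfl
  refine ⟨(AlgEquiv.prodCongr ψ ((AlgEquiv.op ψ).trans (AlgEquiv.opOp F C).symm)).trans swap,
    fun x => rfl, fun p => ?_⟩
  refine AlgEquiv.map_eq_of_mem_iff _ fun x => ?_
  rw [mem_exGr, mem_exGr, and_comm]
  refine and_congr ?_ ?_
  · rw [← hψ, mem_opGr]
    rfl
  · rw [← hψ, mem_opGr, neg_neg]
    rfl

lemma mopMatrix_mem_opGr {Γ : ℤ × G → Submodule F D} {I : Type*} [Fintype I] [DecidableEq I]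
    {γ : I → G} {δ : I → ℤ} (p : ℤ × G) (Y : Matrix I I Dᵐᵒᵖ) :
    (AlgEquiv.mopMatrix : Matrix I I Dᵐᵒᵖ ≃ₐ[F] (Matrix I I D)ᵐᵒᵖ) Y ∈ opGr (matGr Γ γ δ) p ↔
      Y ∈ matGr (opGr Γ) (fun i => (γ i)⁻¹) δ p := by
  have key : ∀ i j, (Y i j).unop ∈ Γ (-p.1 - δ j + δ i, (γ j)⁻¹ * p.2 * γ i) ↔
      Y i j ∈ opGr Γ (p.1 - δ i + δ j, ((γ i)⁻¹)⁻¹ * p.2 * (γ j)⁻¹) := by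
    intro i j
    rw [mem_opGr]
    have h1 : -p.1 - δ j + δ i = -(p.1 - δ i + δ j) := by ring
    have h2 : (γ j)⁻¹ * p.2 * γ i = ((γ i)⁻¹)⁻¹ * p.2 * (γ j)⁻¹ := by
      rw [inv_inv, mul_comm, mul_comm _ p.2, mul_assoc]
    rw [h1, h2]
  rw [mem_opGr]
  exact ⟨fun h i j => (key i j).mp (h j i), fun h i j => (key j i).mpr (h j i)⟩

end Isomorphisms

theorem stmt_11
    (F : Type u) [Field F] (hchar : ringChar F ≠ 2)
    (G : Type v) [CommGroup G] [DecidableEq G] (hG : Group.FG G)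
    (A : Type w) [Ring A] [Algebra F A] [FiniteDimensional F A]
    -- the involution
    (φ : A →ₗ[F] A)
    (hφ₂ : ∀ a, φ (φ a) = a)
    (hφmul : ∀ a b, φ (a * b) = φ b * φ a)
    -- (A,φ) is simple
    (hA2 : ∃ a b : A, a * b ≠ 0)
    (hsimple : ∀ I : Submodule F A,
      (∀ a : A, ∀ x ∈ I, a * x ∈ I ∧ x * a ∈ I) → (∀ x ∈ I, φ x ∈ I) →
      I = ⊥ ∨ I = ⊤)
    -- the (ℤ×G)-grading Γ
    (Γ : ℤ × G → Submodule F A)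
    (hinternal : DirectSum.IsInternal Γ)
    (hone : (1 : A) ∈ Γ (0, 1))
    (hgrmul : ∀ p q : ℤ × G, ∀ x ∈ Γ p, ∀ y ∈ Γ q, x * y ∈ Γ (p.1 + q.1, p.2 * q.2))
    (hφgr : ∀ p : ℤ × G, Submodule.map φ (Γ p) = Γ (-p.1, p.2))
    (hsupp₁ : ∀ p : ℤ × G, Γ p ≠ ⊥ → p.1 = -1 ∨ p.1 = 0 ∨ p.1 = 1)
    (hsupp₂ : ∃ g : G, Γ (-1, g) ≠ ⊥)
    (hsupp₃ : ∃ g : G, Γ (0, g) ≠ ⊥)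
    (hsupp₄ : ∃ g : G, Γ (1, g) ≠ ⊥)
    -- (A,Γ) is not graded-simple
    (hngs : ¬ (∀ J : Submodule F A, (∀ a : A, ∀ x ∈ J, a * x ∈ J ∧ x * a ∈ J) →
      J ≤ ⨆ p : ℤ × G, ((J ⊓ Γ p : Submodule F A)) → J = ⊥ ∨ J = ⊤)) :
    -- first part: (A,φ,Γ) ≅ M(G,D,κ₀,κ₁,γ₀,γ₁)^ex
    (∃ (D : GrAlg.{u, v, w} F (ℤ × G)) (k₀ k₁ : ℕ) (γ₀ : Fin k₀ → G) (γ₁ : Fin k₁ → G)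
        (κ₀ : Fin k₀ → ℕ) (κ₁ : Fin k₁ → ℕ),
      IsGradedDivision D ∧ IsSimpleAlg D ∧ 1 ≤ k₀ ∧ 1 ≤ k₁ ∧
      (∀ i, 0 < κ₀ i) ∧ (∀ i, 0 < κ₁ i) ∧
      -- the entries of γ₀ and of γ₁ are pairwise distinct modulo T = supp D
      (∀ i j : Fin k₀, D.gr (0, (γ₀ i)⁻¹ * γ₀ j) ≠ ⊥ → i = j) ∧
      (∀ i j : Fin k₁, D.gr (0, (γ₁ i)⁻¹ * γ₁ j) ≠ ⊥ → i = j) ∧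
      ∃ e : A ≃ₐ[F]
          (Matrix (RepIdx κ₀ κ₁) (RepIdx κ₀ κ₁) D.carrier ×
            (Matrix (RepIdx κ₀ κ₁) (RepIdx κ₀ κ₁) D.carrier)ᵐᵒᵖ),
        (∀ x : A, e (φ x) = exInv F (Matrix (RepIdx κ₀ κ₁) (RepIdx κ₀ κ₁) D.carrier) (e x)) ∧
        (∀ p : ℤ × G,
          Submodule.map
              (e : A →ₗ[F]
                (Matrix (RepIdx κ₀ κ₁) (RepIdx κ₀ κ₁) D.carrier ×
                  (Matrix (RepIdx κ₀ κ₁) (RepIdx κ₀ κ₁) D.carrier)ᵐᵒᵖ)) (Γ p)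
            = exGr (matGr D.gr (repGamma γ₀ γ₁) (repDelta κ₀ κ₁)) p)) ∧
    -- second part: sufficient conditions for isomorphism of two such models
    (∀ (D D' : GrAlg.{u, v, w} F (ℤ × G)), IsGradedDivision D → IsGradedDivision D' →
      IsSimpleAlg D → IsSimpleAlg D' →
      ∀ T : Subgroup G, (∀ g : G, g ∈ T ↔ D.gr (0, g) ≠ ⊥) →
      (∀ p : ℤ × G, D.gr p ≠ ⊥ → p.1 = 0) → (∀ p : ℤ × G, D'.gr p ≠ ⊥ → p.1 = 0) →
      ∀ (k₀ k₁ k₀' k₁' : ℕ), 1 ≤ k₀ → 1 ≤ k₁ → 1 ≤ k₀' → 1 ≤ k₁' →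
      ∀ (γ₀ : Fin k₀ → G) (γ₁ : Fin k₁ → G) (γ₀' : Fin k₀' → G) (γ₁' : Fin k₁' → G),
      ∀ (κ₀ : Fin k₀ → ℕ) (κ₁ : Fin k₁ → ℕ) (κ₀' : Fin k₀' → ℕ) (κ₁' : Fin k₁' → ℕ),
      (∀ i, 0 < κ₀ i) → (∀ i, 0 < κ₁ i) → (∀ i, 0 < κ₀' i) → (∀ i, 0 < κ₁' i) →
      -- distinctness modulo the supports
      (∀ i j : Fin k₀, D.gr (0, (γ₀ i)⁻¹ * γ₀ j) ≠ ⊥ → i = j) →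
      (∀ i j : Fin k₁, D.gr (0, (γ₁ i)⁻¹ * γ₁ j) ≠ ⊥ → i = j) →
      (∀ i j : Fin k₀', D'.gr (0, (γ₀' i)⁻¹ * γ₀' j) ≠ ⊥ → i = j) →
      (∀ i j : Fin k₁', D'.gr (0, (γ₁' i)⁻¹ * γ₁' j) ≠ ⊥ → i = j) →
      -- hypothesis: (1) or (2)
      (((∃ f : D.carrier ≃ₐ[F] D'.carrier,
           ∀ p : ℤ × G, Submodule.map (f : D.carrier →ₗ[F] D'.carrier) (D.gr p) = D'.gr p) ∧
         ∃ g : G, Xi T 1 κ₀ γ₀ = Xi T g κ₀' γ₀' ∧ Xi T 1 κ₁ γ₁ = Xi T g κ₁' γ₁') ∨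
       ((∃ f : D.carrier ≃ₐ[F] D'.carrierᵐᵒᵖ,
           ∀ p : ℤ × G,
             Submodule.map (f : D.carrier →ₗ[F] D'.carrierᵐᵒᵖ) (D.gr p) = opGr D'.gr p) ∧
         ∃ g : G, Xi T 1 κ₀ γ₀ = Xi T g κ₀' (fun i => (γ₀' i)⁻¹) ∧
           Xi T 1 κ₁ γ₁ = Xi T g κ₁' fun i => (γ₁' i)⁻¹)) →
      -- conclusion: the exchange models are isomorphic as graded algebras with involution
      ∃ e : (Matrix (RepIdx κ₀ κ₁) (RepIdx κ₀ κ₁) D.carrier ×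
            (Matrix (RepIdx κ₀ κ₁) (RepIdx κ₀ κ₁) D.carrier)ᵐᵒᵖ) ≃ₐ[F]
          (Matrix (RepIdx κ₀' κ₁') (RepIdx κ₀' κ₁') D'.carrier ×
            (Matrix (RepIdx κ₀' κ₁') (RepIdx κ₀' κ₁') D'.carrier)ᵐᵒᵖ),
        (∀ x, e (exInv F (Matrix (RepIdx κ₀ κ₁) (RepIdx κ₀ κ₁) D.carrier) x)
            = exInv F (Matrix (RepIdx κ₀' κ₁') (RepIdx κ₀' κ₁') D'.carrier) (e x)) ∧
        (∀ p : ℤ × G,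
          Submodule.map
              (e : (Matrix (RepIdx κ₀ κ₁) (RepIdx κ₀ κ₁) D.carrier ×
                    (Matrix (RepIdx κ₀ κ₁) (RepIdx κ₀ κ₁) D.carrier)ᵐᵒᵖ) →ₗ[F]
                (Matrix (RepIdx κ₀' κ₁') (RepIdx κ₀' κ₁') D'.carrier ×
                  (Matrix (RepIdx κ₀' κ₁') (RepIdx κ₀' κ₁') D'.carrier)ᵐᵒᵖ))
              (exGr (matGr D.gr (repGamma γ₀ γ₁) (repDelta κ₀ κ₁)) p)
            = exGr (matGr D'.gr (repGamma γ₀' γ₁') (repDelta κ₀' κ₁')) p)) := by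
  refine ⟨?_, ?_⟩
  · push Not at hngs
    obtain ⟨J, hJ, hJgr, hJbot, hJtop⟩ := hngs
    exact exists_exchange_model φ hφ₂ hφmul hsimple Γ hinternal hone hgrmul hφgr hsupp₁ hsupp₄ hJ
      hJgr hJbot hJtop
  · intro D D' hD _ _ _ T hT _ _ k₀ k₁ k₀' k₁' _ _ _ _ γ₀ γ₁ γ₀' γ₁' κ₀ κ₁ κ₀' κ₁' _ _ _ _ _ _ _ _
      hiso
    rcases hiso with ⟨⟨f, hf⟩, g, h₀, h₁⟩ | ⟨⟨f, hf⟩, g, h₀, h₁⟩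
    · obtain ⟨σ, hσ⟩ := exists_repIdx_equiv_of_xi_eq h₀ h₁
      choose u hu hu' using fun i => exists_homogeneous_units hD ((hT _).mp (hσ i).2)
      obtain ⟨ψ, hψ⟩ := exists_graded_matrix_equiv hD.1.2.2 f
        (fun p => AlgEquiv.mem_iff_of_map_eq f (hf p)) σ (fun i => (hσ i).1) u hu hu'
      exact exists_exchange_equiv ψ hψ
    · obtain ⟨σ, hσ⟩ := exists_repIdx_equiv_of_xi_eq h₀ h₁
      choose u hu hu' using fun i => exists_homogeneous_units hD ((hT _).mp (hσ i).2)
      obtain ⟨ψ, hψ⟩ := exists_graded_matrix_equiv hD.1.2.2 f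
        (fun p => AlgEquiv.mem_iff_of_map_eq f (hf p)) σ (fun i => (hσ i).1) u hu hu'
      refine exists_exchange_equiv_of_op (ψ.trans AlgEquiv.mopMatrix) fun p X => ?_
      rw [← hψ p X, AlgEquiv.trans_apply, mopMatrix_mem_opGr]
      have hγ : repGamma (κ₀ := κ₀') (κ₁ := κ₁') (fun i => (γ₀' i)⁻¹) (fun i => (γ₁' i)⁻¹) =
          fun i => (repGamma γ₀' γ₁' i)⁻¹ := by
        ext (i | i) <;> rfl
      rw [hγ]
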